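/- Assume GRH: for every Dirichlet character χ, every zero s of the Dirichlet L-function L(s,χ) with 0 < Re s < 1 satisfies Re s = 1/2. Fix an integer k ≥ 2 and ε > 0. There is a constant C_ε such that for all Q ≥ 1 and X ≥ 2, |EG_k(Q;X)| ≤ C_ε · X^{2+ε}/Q. -/

import Mathlib

open MeasureTheory Complex
open scoped Classical

/-- `d_k(n)`: number of ordered k-tuples of positive integers with product n. -/
noncomputable def dk (k n : ℕ) : ℕ :=
  Nat.card {f : Fin k → ℕ // (∀ i, 0 < f i) ∧ ∏ i, f i = n}

/-- The off-diagonal error term `EG_k(Q;X)`, a sum over non-principal Dirichlet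
characters. -/
noncomputable def EGk (k : ℕ) (Φ Ψ : ℝ → ℝ) (Q X : ℝ) : ℂ :=
  ∑' m : ℕ, ∑' n : ℕ, ∑' a : ℕ, ∑' r : ℕ,
    if 1 ≤ m ∧ 1 ≤ n ∧ 1 ≤ r ∧ a ∣ Nat.gcd m n then
      (((dk k m : ℝ) * (dk k n : ℝ) * Ψ ((m : ℝ) / X) * Ψ ((n : ℝ) / X) *
          (((ArithmeticFunction.moebius a : ℤ) : ℝ) / (Nat.totient (a * r) : ℝ)) *
          Φ (|((m / Nat.gcd m n : ℕ) : ℝ) - ((n / Nat.gcd m n : ℕ) : ℝ)| /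
              ((r : ℝ) * Q)) : ℝ) : ℂ) *
        ∑' χ : DirichletCharacter ℂ (a * r),
          (if χ ≠ 1 then
            χ (((m / Nat.gcd m n : ℕ) : ZMod (a * r))) *
              (starRingEnd ℂ) (χ (((n / Nat.gcd m n : ℕ) : ZMod (a * r))))
          else 0)
    else 0

/-- GRH: all nontrivial zeros of Dirichlet L-functions lie on the critical line. -/
def GRH : Prop :=
  ∀ (N : ℕ) [NeZero N] (χ : DirichletCharacter ℂ N) (s : ℂ),
    DirichletCharacter.LFunction χ s = 0 → 0 < s.re → s.re < 1 → s.re = 1/2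

section CharacterSums

/-- The partial sums of a nonprincipal Dirichlet character are bounded by the modulus. -/
lemma norm_sum_character_le {N : ℕ} [NeZero N] {χ : DirichletCharacter ℂ N} (hχ : χ ≠ 1) (n : ℕ) :
    ‖∑ k ∈ Finset.Icc 1 n, χ (k : ZMod N)‖ ≤ N := by
  have hper : ∀ n : ℕ, ∑ k ∈ Finset.Ico n (n + N), χ (k : ZMod N) = 0 := by
    intro n
    have h1 : ∑ k ∈ Finset.range N, χ (k : ZMod N) = 0 := by
      rw [← MulChar.sum_eq_zero_of_ne_one hχ]
      refine Finset.sum_nbij' (fun k : ℕ => (k : ZMod N)) (fun a => a.val) ?_ ?_ ?_ ?_ ?_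
      · simp
      · intro a _; simpa using ZMod.val_lt a
      · intro k hk; simpa using Nat.mod_eq_of_lt (by simpa using hk)
      · simp
      · simp
    induction n with
    | zero => simpa using h1
    | succ n ih =>
      have hN := NeZero.pos N
      rw [Finset.sum_Ico_eq_sum_range] at ih ⊢
      have e1 : n + N - n = N := by omega
      have e2 : n + 1 + N - (n + 1) = N := by omega
      rw [e1] at ih
      rw [e2]
      obtain ⟨M, rfl⟩ : ∃ M, N = M + 1 := ⟨N - 1, by omega⟩
      rw [Finset.sum_range_succ'] at ih
      rw [Finset.sum_range_succ]
      rw [← ih]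
      congr 1
      · refine Finset.sum_congr rfl fun k _ => ?_
        congr 2; ring
      · congr 1
        have : ((M + 1 : ℕ) : ZMod (M + 1)) = 0 := ZMod.natCast_self _
        push_cast at this ⊢
        linear_combination this
  induction n using Nat.strong_induction_on with
  | _ n ih =>
    rcases lt_or_ge n N with h | h
    · calc ‖∑ k ∈ Finset.Icc 1 n, χ (k : ZMod N)‖ ≤ ∑ k ∈ Finset.Icc 1 n, ‖χ (k : ZMod N)‖ :=
            norm_sum_le _ _
        _ ≤ ∑ k ∈ Finset.Icc 1 n, (1 : ℝ) := Finset.sum_le_sum fun k _ => χ.norm_le_one _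
        _ ≤ N := by simp; exact_mod_cast h.le
    · have hN := NeZero.pos N
      have e : ∑ k ∈ Finset.Icc 1 n, χ (k : ZMod N) =
          ∑ k ∈ Finset.Icc 1 (n - N), χ (k : ZMod N) := by
        have h2 := hper (n - N + 1)
        have h3 : Finset.Icc 1 n = Finset.Ico 1 (n + 1) := by ext; simp
        have h4 : Finset.Icc 1 (n - N) = Finset.Ico 1 (n - N + 1) := by ext; simp
        rw [h3, h4, ← Finset.sum_Ico_consecutive _ (show 1 ≤ n - N + 1 by omega)
          (show n - N + 1 ≤ n + 1 by omega)]
        have e3 : n - N + 1 + N = n + 1 := by omega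
        rw [e3] at h2
        rw [h2, add_zero]
      rw [e]
      exact ih _ (by omega)

/-- A polynomial bound for the Dirichlet `L`-function of a nonprincipal character. -/
lemma norm_LFunction_le {N : ℕ} [NeZero N] {χ : DirichletCharacter ℂ N} (hχ : χ ≠ 1) {s : ℂ}
    (hs : 0 < s.re) : ‖χ.LFunction s‖ ≤ N * ‖s‖ / s.re := by
  set S : ℝ → ℂ := fun t => ∑ k ∈ Finset.Icc 1 ⌊t⌋₊, χ (k : ZMod N) with hS
  set A : ℝ → ℂ := (Set.Ioi (1 : ℝ)).indicator S with hA
  have hSm : Measurable S := by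
    have : S = (fun n : ℕ => ∑ k ∈ Finset.Icc 1 n, χ (k : ZMod N)) ∘ (fun t : ℝ => ⌊t⌋₊) := rfl
    rw [this]
    exact (measurable_from_top).comp Nat.measurable_floor
  have hAm : Measurable A := hSm.indicator measurableSet_Ioi
  have hAb : ∀ t, ‖A t‖ ≤ N := by
    intro t
    rw [hA]
    refine (norm_indicator_le_norm_self _ _).trans (norm_sum_character_le hχ _)
  have hmel : ∀ z : ℂ, mellin A (-z) = ∫ t in Set.Ioi (1 : ℝ), S t * (t : ℂ) ^ (-(z + 1)) := by
    intro z
    have : ∀ t : ℝ, (t : ℂ) ^ (-z - 1) • A t =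
        (Set.Ioi (1 : ℝ)).indicator (fun t : ℝ => S t * (t : ℂ) ^ (-(z + 1))) t := by
      intro t
      by_cases ht : t ∈ Set.Ioi (1 : ℝ)
      · simp only [hA, Set.indicator_of_mem ht, smul_eq_mul]
        rw [mul_comm]; congr 2; ring
      · simp only [hA, Set.indicator_of_notMem ht, smul_zero]
    rw [mellin]
    simp_rw [this]
    rw [setIntegral_indicator measurableSet_Ioi]
    rw [Set.inter_eq_self_of_subset_right (Set.Ioi_subset_Ioi zero_le_one)]
  have hdiff : ∀ z : ℂ, 0 < z.re → DifferentiableAt ℂ (fun z => z * mellin A (-z)) z := by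
    intro z hz
    have h1 : DifferentiableAt ℂ (mellin A) (-z) := by
      refine mellin_differentiableAt_of_isBigO_rpow (a := 0) (b := -z.re - 1) ?_ ?_ ?_ ?_ ?_
      · refine (locallyIntegrable_const (N : ℝ)).mono hAm.aestronglyMeasurable ?_ |>.locallyIntegrableOn _
        exact Filter.Eventually.of_forall fun t => (hAb t).trans (Real.le_norm_self _)
      · refine Asymptotics.IsBigO.of_bound N ?_
        exact Filter.Eventually.of_forall fun t => by simpa using hAb t
      · simpa using hz
      · refine Asymptotics.IsBigO.of_bound 0 ?_
        have : ∀ᶠ t : ℝ in nhdsWithin 0 (Set.Ioi 0), t < 1 :=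
          nhdsWithin_le_nhds (eventually_lt_nhds one_pos)
        filter_upwards [this] with t ht
        have : A t = 0 := Set.indicator_of_notMem (by simpa using ht.le) _
        simp [this]
      · simp
    exact differentiableAt_id.mul (h1.comp z differentiableAt_id.neg)
  have heq1 : ∀ z : ℂ, 1 < z.re → χ.LFunction z = z * mellin A (-z) := by
    intro z hz
    rw [hmel, DirichletCharacter.LFunction_eq_LSeries χ hz]
    refine LSeries_eq_mul_integral (fun n => χ (n : ZMod N)) (le_refl 0) (by linarith)
      (χ.LSeriesSummable_of_one_lt_re hz) ?_
    refine Asymptotics.IsBigO.of_bound N ?_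
    exact Filter.Eventually.of_forall fun n => by simpa using norm_sum_character_le hχ n
  have heq : χ.LFunction s = s * mellin A (-s) := by
    have hopen : IsOpen {z : ℂ | 0 < z.re} := isOpen_lt continuous_const Complex.continuous_re
    have hconn : IsPreconnected {z : ℂ | 0 < z.re} :=
      (convex_halfSpace_re_gt 0).isPreconnected
    refine AnalyticOnNhd.eqOn_of_preconnected_of_eventuallyEq (𝕜 := ℂ) (z₀ := 2)
      (f := χ.LFunction) (g := fun z => z * mellin A (-z)) ?_ ?_ hconn ?_ ?_ hs
    · exact fun z _ => (DirichletCharacter.differentiable_LFunction hχ).analyticAt z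
    · exact DifferentiableOn.analyticOnNhd (E := ℂ) (fun z hz => (hdiff z hz).differentiableWithinAt) hopen
    · simp
    · have : ∀ᶠ z : ℂ in nhds 2, 1 < z.re :=
        (isOpen_lt continuous_const Complex.continuous_re).mem_nhds (by simp)
      filter_upwards [this] with z hz using heq1 z hz
  have h_int : ‖mellin A (-s)‖ ≤ N / s.re := by
    rw [hmel]
    have hI : ∫ t in Set.Ioi (1 : ℝ), (N : ℝ) * t ^ (-s.re - 1) = N / s.re := by
      rw [integral_const_mul, integral_Ioi_rpow_of_lt (by linarith) one_pos]
      simp; field_simp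
    rw [← hI]
    refine norm_integral_le_of_norm_le ?_ ?_
    · exact (integrableOn_Ioi_rpow_of_lt (by linarith) one_pos).const_mul _
    · refine (ae_restrict_iff' measurableSet_Ioi).2 (Filter.Eventually.of_forall fun t ht => ?_)
      have ht' : (0 : ℝ) < t := lt_trans one_pos ht
      rw [norm_mul, Complex.norm_cpow_eq_rpow_re_of_pos ht']
      have : (-(s + 1)).re = -s.re - 1 := by simp; ring
      rw [this]
      gcongr
      exact norm_sum_character_le hχ _
  rw [heq, norm_mul]
  calc ‖s‖ * ‖mellin A (-s)‖ ≤ ‖s‖ * (N / s.re) := by gcongr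
    _ = N * ‖s‖ / s.re := by ring

end CharacterSums

section Lindelof

open Metric

/-- A Borel–Carathéodory type bound for the logarithmic derivative of a zero-free function. -/
lemma norm_logDeriv_le_of_ne_zero {f : ℂ → ℂ} {c : ℂ} {r R M : ℝ} (hr : 0 < r) (hrR : r < R)
    (hM : 0 < M) (hf : DifferentiableOn ℂ f (ball c R)) (hne : ∀ z ∈ ball c R, f z ≠ 0)
    (hb : ∀ z ∈ ball c R, ‖f z‖ ≤ Real.exp M * ‖f c‖) {z : ℂ} (hz : z ∈ closedBall c r) :
    ‖deriv f z / f z‖ ≤ 8 * R / (R - r) ^ 2 * M := by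
  have hR : 0 < R := hr.trans hrR
  have hdf : DifferentiableOn ℂ (fun z => deriv f z / f z) (ball c R) :=
    (hf.deriv isOpen_ball).div hf hne
  obtain ⟨g, hg⟩ := hdf.isExactOn_ball
  set h : ℂ → ℂ := fun z => g z - g c with hh
  have hh' : ∀ z ∈ ball c R, HasDerivAt h (deriv f z / f z) z := fun z hz => (hg z hz).sub_const _
  have hconst : ∀ z ∈ ball c R, f z * Complex.exp (-h z) = f c := by
    intro z hz
    have hd : ∀ z ∈ ball c R, HasDerivAt (fun z => f z * Complex.exp (-h z)) 0 z := by
      intro z hz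
      have h1 : HasDerivAt f (deriv f z) z :=
        (hf.differentiableAt (isOpen_ball.mem_nhds hz)).hasDerivAt
      have h2 := h1.mul (hh' z hz).neg.cexp
      refine h2.congr_deriv ?_
      have e : f z * (deriv f z / f z) = deriv f z := mul_div_cancel₀ _ (hne z hz)
      linear_combination -Complex.exp (-h z) * e
    have := isOpen_ball.is_const_of_deriv_eq_zero (convex_ball c R).isPreconnected
      (fun z hz => (hd z hz).differentiableAt.differentiableWithinAt)
      (fun z hz => (hd z hz).deriv) hz (mem_ball_self hR)
    rw [this]
    simp [hh]
  have hre : ∀ z ∈ ball c R, (h z).re ≤ M := by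
    intro z hz
    have h1 := hconst z hz
    have hc : 0 < ‖f c‖ := norm_pos_iff.2 (hne c (mem_ball_self hR))
    have h2 : ‖f z‖ = Real.exp (h z).re * ‖f c‖ := by
      rw [← h1, norm_mul, Complex.norm_exp]
      rw [mul_comm, mul_assoc, ← Real.exp_add]
      simp
    have h3 := hb z hz
    rw [h2] at h3
    exact Real.exp_le_exp.1 (le_of_mul_le_mul_right h3 hc)
  set ρ := (R + r) / 2 with hρ
  have hball : ∀ w ∈ closedBall c ρ, ‖h w‖ ≤ 4 * M * R / (R - r) := by
    intro w hw
    have hwn : ‖w - c‖ ≤ ρ := by simpa [dist_eq_norm] using hw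
    have hmem : w - c ∈ ball (0 : ℂ) R := by
      simp; linarith
    have hmaps : ∀ x ∈ ball (0 : ℂ) R, c + x ∈ ball c R := by
      intro x hx; simpa [dist_eq_norm] using hx
    have h1 := Complex.borelCaratheodory_zero (f := fun x => h (c + x)) hM (R := R) (z := w - c)
      (fun x hx => ((hh' (c + x) (hmaps x hx)).differentiableAt.comp x
        (differentiableAt_id.const_add c)).differentiableWithinAt)
      (fun x hx => hre _ (hmaps x hx)) hR hmem (by simp [hh])
    simp only [add_sub_cancel] at h1
    refine h1.trans ?_
    have h3 : 0 < R - ‖w - c‖ := by linarith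
    rw [div_le_div_iff₀ h3 (by linarith)]
    have h4 : 2 * M * ‖w - c‖ ≤ 2 * M * R := by
      gcongr; linarith
    have h5 : (R - r) ≤ 2 * (R - ‖w - c‖) := by linarith
    calc 2 * M * ‖w - c‖ * (R - r) ≤ 2 * M * R * (2 * (R - ‖w - c‖)) := by
          gcongr
      _ = _ := by ring
  have hzn : ‖z - c‖ ≤ r := by simpa [dist_eq_norm] using hz
  have hzR : z ∈ ball c R := by simp [dist_eq_norm]; linarith
  rw [← (hh' z hzR).deriv]
  have hε : 0 < (R - r) / 2 := by linarith
  have hsub : closedBall z ((R - r) / 2) ⊆ closedBall c ρ := by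
    apply closedBall_subset_closedBall'
    rw [dist_eq_norm]; linarith
  have hsub2 : closedBall c ρ ⊆ ball c R := closedBall_subset_ball (by linarith)
  have := Complex.norm_deriv_le_of_forall_mem_sphere_norm_le (f := h) (c := z) hε
    (C := 4 * M * R / (R - r)) ?_ ?_
  · refine this.trans (le_of_eq ?_)
    have : R - r ≠ 0 := by linarith
    field_simp
    ring
  · refine DifferentiableOn.diffContOnCl fun w hw => ?_
    have : w ∈ closedBall z ((R - r) / 2) := closure_ball_subset_closedBall hw
    exact (hh' w (hsub2 (hsub this))).differentiableAt.differentiableWithinAt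
  · intro w hw
    exact hball w (hsub (sphere_subset_closedBall hw))

/-- The bounds on the line `Re s = 2`. -/
lemma exists_bound_LFunction_re_two : ∃ Z : ℝ, 1 ≤ Z ∧ ∀ (N : ℕ) [NeZero N]
    (χ : DirichletCharacter ℂ N) (s : ℂ), s.re = 2 → ‖χ.LFunction s‖ ≤ Z ∧
      1 ≤ Z * ‖χ.LFunction s‖ ∧ ‖deriv χ.LFunction s / χ.LFunction s‖ ≤ Z := by
  have hsum2 : Summable (fun n : ℕ => ‖LSeries.term 1 (2 : ℂ) n‖) :=
    (LSeriesSummable_one_iff.2 (by simp)).norm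
  have hsumL : Summable (fun n : ℕ => ‖LSeries.term (fun n => (ArithmeticFunction.vonMangoldt n : ℂ)) (2 : ℂ) n‖) :=
    (ArithmeticFunction.LSeriesSummable_vonMangoldt (by simp)).norm
  set Z1 := ∑' n : ℕ, ‖LSeries.term 1 (2 : ℂ) n‖ with hZ1
  set Z2 := ∑' n : ℕ, ‖LSeries.term (fun n => (ArithmeticFunction.vonMangoldt n : ℂ)) (2 : ℂ) n‖
  have hZ1p : 0 ≤ Z1 := tsum_nonneg fun _ => norm_nonneg _
  have hZ2p : 0 ≤ Z2 := tsum_nonneg fun _ => norm_nonneg _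
  have key : ∀ (f g : ℕ → ℂ) (s : ℂ), s.re = 2 → (∀ n, ‖f n‖ ≤ ‖g n‖) →
      Summable (fun n : ℕ => ‖LSeries.term g (2 : ℂ) n‖) →
      ‖LSeries f s‖ ≤ ∑' n : ℕ, ‖LSeries.term g (2 : ℂ) n‖ := by
    intro f g s hs hfg hg
    have h1 : ∀ n, ‖LSeries.term f s n‖ ≤ ‖LSeries.term g (2 : ℂ) n‖ := fun n => by
      refine (LSeries.norm_term_le s (hfg n)).trans (le_of_eq ?_)
      rw [LSeries.norm_term_eq, LSeries.norm_term_eq, hs]; simp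
    exact tsum_of_norm_bounded hg.hasSum h1
  refine ⟨1 + Z1 + Z2, by linarith, fun N _ χ s hs => ?_⟩
  have hs1 : 1 < s.re := by linarith
  have hL : χ.LFunction s = LSeries (fun n => χ (n : ZMod N)) s :=
    DirichletCharacter.LFunction_eq_LSeries χ hs1
  have hLn : ‖χ.LFunction s‖ ≤ Z1 := by
    rw [hL]
    exact key _ 1 s hs (fun n => by simpa using χ.norm_le_one _) hsum2
  have hinv : χ.LFunction s * LSeries ((fun n : ℕ => χ (n : ZMod N)) *
      (fun n : ℕ => (ArithmeticFunction.moebius n : ℂ))) s = 1 := by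
    rw [hL]; exact DirichletCharacter.LSeries.mul_mu_eq_one χ hs1
  have hμ : ‖LSeries ((fun n : ℕ => χ (n : ZMod N)) *
      (fun n : ℕ => (ArithmeticFunction.moebius n : ℂ))) s‖ ≤ Z1 := by
    refine key _ 1 s hs (fun n => ?_) hsum2
    simp only [Pi.mul_apply, norm_mul, Pi.one_apply, norm_one]
    have h1 := χ.norm_le_one (n : ZMod N)
    have h2 : ‖((ArithmeticFunction.moebius n : ℤ) : ℂ)‖ ≤ 1 := by
      rw [Complex.norm_intCast]
      exact_mod_cast ArithmeticFunction.abs_moebius_le_one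
    calc _ ≤ (1 : ℝ) * 1 := by gcongr
      _ = 1 := one_mul 1
  refine ⟨by linarith, ?_, ?_⟩
  · have h1 := congrArg norm hinv
    rw [norm_mul, norm_one] at h1
    rw [← h1, mul_comm]
    gcongr
    linarith
  · have hd : deriv χ.LFunction s = deriv (LSeries (fun n => χ (n : ZMod N))) s :=
      DirichletCharacter.deriv_LFunction_eq_deriv_LSeries χ hs1
    have h1 := DirichletCharacter.LSeries_twist_vonMangoldt_eq χ hs1
    rw [hd, hL, ← norm_neg, ← neg_div, ← h1]
    refine (key _ (fun n => (ArithmeticFunction.vonMangoldt n : ℂ)) s hs (fun n => ?_) hsumL).trans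
      (by linarith)
    simp only [Pi.mul_apply, norm_mul]
    exact mul_le_of_le_one_left (norm_nonneg _) (χ.norm_le_one _)

end Lindelof

section Lindelof

open Metric

/-- Under GRH, the `L`-function of a nonprincipal character has no zeros with `Re s > 1 / 2`. -/
lemma GRH.LFunction_ne_zero (hGRH : GRH) {N : ℕ} [NeZero N] {χ : DirichletCharacter ℂ N}
    (hχ : χ ≠ 1) {s : ℂ} (hs : 1 / 2 < s.re) : χ.LFunction s ≠ 0 := by
  rcases lt_or_ge s.re 1 with h | h
  · intro h0
    have := hGRH N χ s h0 (by linarith) h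
    linarith
  · exact DirichletCharacter.LFunction_ne_zero_of_one_le_re χ (.inl hχ) h

lemma two_le_conductor_mul {N : ℕ} [NeZero N] (t : ℝ) : 2 ≤ (N : ℝ) * (|t| + 2) := by
  have h1 : (1 : ℝ) ≤ N := by exact_mod_cast NeZero.one_le
  nlinarith [abs_nonneg t]

/-- Under GRH, the logarithmic derivative is `O(log(N (|t| + 2)))` to the right of the critical
line. -/
lemma GRH.norm_logDeriv_le_log (hGRH : GRH) {δ : ℝ} (hδ : 0 < δ) (hδ' : δ < 1) :
    ∃ C : ℝ, 0 < C ∧ ∀ (N : ℕ) [NeZero N] (χ : DirichletCharacter ℂ N), χ ≠ 1 → ∀ s : ℂ,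
      1 / 2 + δ ≤ s.re → s.re ≤ 2 →
      ‖deriv χ.LFunction s / χ.LFunction s‖ ≤ C * Real.log (N * (|s.im| + 2)) := by
  obtain ⟨Z, hZ1, hZ⟩ := exists_bound_LFunction_re_two
  have hl2 : 0 < Real.log 2 := Real.log_pos one_lt_two
  have hl4 : 0 < Real.log (4 * Z) := Real.log_pos (by linarith)
  set K := 8 * (3 / 2 : ℝ) / (3 / 2 - (3 / 2 - δ)) ^ 2 with hK
  have hKpos : 0 < K := by rw [hK]; ring_nf; positivity
  refine ⟨K * (Real.log (4 * Z) / Real.log 2 + 1), by positivity, fun N _ χ hχ s hs1 hs2 => ?_⟩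
  set T : ℝ := N * (|s.im| + 2) with hT
  have hT2 : 2 ≤ T := two_le_conductor_mul _
  have hlT : Real.log 2 ≤ Real.log T := Real.log_le_log two_pos hT2
  set c : ℂ := ⟨2, s.im⟩ with hc
  have hdist : ‖s - c‖ = 2 - s.re := by
    have : s - c = ((s.re - 2 : ℝ) : ℂ) := by apply Complex.ext <;> simp [hc]
    rw [this, Complex.norm_real, Real.norm_eq_abs, abs_of_nonpos (by linarith)]; ring
  have hball : ∀ z ∈ ball c (3 / 2), 1 / 2 < z.re := by
    intro z hz
    have h1 : ‖z - c‖ < 3 / 2 := by simpa [dist_eq_norm] using hz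
    have h2 := (abs_le.1 (Complex.abs_re_le_norm (z - c))).1
    simp [hc] at h2 h1
    linarith
  obtain ⟨_, hc2, _⟩ := hZ N χ c rfl
  have hmain := norm_logDeriv_le_of_ne_zero (f := χ.LFunction) (c := c) (r := 3 / 2 - δ)
    (R := 3 / 2) (M := Real.log (4 * Z * T)) (z := s) (by linarith) (by linarith)
    (Real.log_pos (by nlinarith))
    (DirichletCharacter.differentiable_LFunction hχ).differentiableOn
    (fun z hz => hGRH.LFunction_ne_zero hχ (hball z hz)) ?_ ?_
  · refine hmain.trans ?_
    rw [Real.log_mul (by positivity) (by positivity), ← hK, mul_assoc]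
    gcongr
    have : Real.log (4 * Z) ≤ Real.log (4 * Z) / Real.log 2 * Real.log T := by
      rw [div_mul_eq_mul_div, le_div_iff₀ hl2]; gcongr
    linarith
  · intro z hz
    have hzre := hball z hz
    have h1 : ‖z - c‖ ≤ 3 / 2 := by
      have := mem_ball.1 hz
      rw [dist_eq_norm] at this
      exact this.le
    have hcn : ‖c‖ ≤ 2 + |s.im| := by
      have := Complex.norm_le_abs_re_add_abs_im c
      simpa [hc] using this
    have h3 : ‖z‖ ≤ 2 * (|s.im| + 2) := by
      have := norm_le_norm_add_norm_sub' z c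
      have := abs_nonneg s.im
      linarith
    have h4 := norm_LFunction_le hχ (s := z) (by linarith)
    rw [Real.exp_log (by positivity)]
    calc ‖χ.LFunction z‖ ≤ N * ‖z‖ / z.re := h4
      _ ≤ N * ‖z‖ / (1 / 2) := by gcongr
      _ ≤ N * (2 * (|s.im| + 2)) / (1 / 2) := by gcongr
      _ = 4 * T * 1 := by rw [hT]; ring
      _ ≤ 4 * T * (Z * ‖χ.LFunction c‖) := by gcongr
      _ = _ := by ring
  · rw [mem_closedBall, dist_eq_norm, hdist]; linarith

lemma norm_exp_sub_sq_le {s : ℂ} {t : ℝ} (h0 : 0 ≤ s.re) (h2 : s.re ≤ 2) :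
    ‖Complex.exp ((s - t * I) ^ 2)‖ ≤ Real.exp 4 * Real.exp (-(s.im - t) ^ 2) := by
  rw [Complex.norm_exp, ← Real.exp_add]
  apply Real.exp_le_exp.2
  simp [pow_two]
  nlinarith

/-- Under GRH, the logarithmic derivative is bounded by a power of `log(N (|t| + 2))` with exponent
less than one to the right of the critical line. -/
lemma GRH.norm_logDeriv_le_log_rpow (hGRH : GRH) {δ : ℝ} (hδ : 0 < δ) (hδ' : δ < 1 / 2) :
    ∃ C κ : ℝ, 0 < C ∧ 0 < κ ∧ κ < 1 ∧ ∀ (N : ℕ) [NeZero N] (χ : DirichletCharacter ℂ N), χ ≠ 1 →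
      ∀ s : ℂ, 1 / 2 + 2 * δ ≤ s.re → s.re ≤ 2 →
      ‖deriv χ.LFunction s / χ.LFunction s‖ ≤ C * (Real.log (N * (|s.im| + 2))) ^ (1 - κ) := by
  obtain ⟨C, hC, hlog⟩ := hGRH.norm_logDeriv_le_log hδ (by linarith)
  obtain ⟨Z, hZ1, hZ⟩ := exists_bound_LFunction_re_two
  have hl2 : 0 < Real.log 2 := Real.log_pos one_lt_two
  set κ := δ / (3 / 2 - δ) with hκ
  have hκ0 : 0 < κ := div_pos hδ (by linarith)
  have hκ1 : κ < 1 := (div_lt_one (by linarith)).2 (by linarith)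
  set b := Real.exp 4 * Z with hb
  have hb1 : 0 < b := by positivity
  set C1 := Real.exp 4 * C * (1 / Real.log 2 + 1) + b / Real.log 2 with hC1
  have hC1p : 0 < C1 := by positivity
  refine ⟨C1 ^ (1 - κ) * b ^ κ, κ, by positivity, hκ0, hκ1, fun N _ χ hχ s hs1 hs2 => ?_⟩
  set T : ℝ := N * (|s.im| + 2) with hT
  have hT2 : 2 ≤ T := two_le_conductor_mul _
  have hlT : Real.log 2 ≤ Real.log T := Real.log_le_log two_pos hT2
  have hlT0 : 0 < Real.log T := hl2.trans_le hlT
  set f : ℂ → ℂ := fun z => deriv χ.LFunction z / χ.LFunction z *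
    Complex.exp ((z - s.im * I) ^ 2) with hf
  have hbd : ∀ z : ℂ, 1 / 2 + δ ≤ z.re → z.re ≤ 2 → ‖f z‖ ≤ C1 * Real.log T := by
    intro z hz1 hz2
    have h1 := hlog N χ hχ z hz1 hz2
    have h2 := norm_exp_sub_sq_le (s := z) (t := s.im) (by linarith) hz2
    set u := |z.im - s.im| with hu
    have h3 : Real.log (N * (|z.im| + 2)) ≤ Real.log T + u := by
      have hN : (1 : ℝ) ≤ N := by exact_mod_cast NeZero.one_le
      have hu0 : 0 ≤ u := abs_nonneg _
      have : |z.im| + 2 ≤ (|s.im| + 2) * (1 + u) := by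
        have : |z.im| ≤ |s.im| + u := by
          have := abs_add_le s.im (z.im - s.im)
          simpa using this
        nlinarith [abs_nonneg s.im]
      calc Real.log (N * (|z.im| + 2)) ≤ Real.log (T * (1 + u)) := by
            apply Real.log_le_log
            · have := two_le_conductor_mul (N := N) z.im; linarith
            · rw [hT, mul_assoc]; gcongr
        _ = Real.log T + Real.log (1 + u) := Real.log_mul (by positivity) (by positivity)
        _ ≤ Real.log T + u := by
            have := Real.log_le_sub_one_of_pos (show 0 < 1 + u by positivity)
            linarith
    have h4 : u * Real.exp (-(z.im - s.im) ^ 2) ≤ 1 := by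
      have e : (z.im - s.im) ^ 2 = u ^ 2 := (sq_abs _).symm
      rw [e, Real.exp_neg, ← div_eq_mul_inv, div_le_one (Real.exp_pos _)]
      nlinarith [Real.add_one_le_exp (u ^ 2), sq_nonneg (u - 1)]
    have h5 : Real.exp (-(z.im - s.im) ^ 2) ≤ 1 := Real.exp_le_one_iff.2 (by nlinarith)
    have h6 : 1 ≤ 1 / Real.log 2 * Real.log T := by
      rw [one_div_mul_eq_div, le_div_iff₀ hl2]; linarith
    rw [hf, norm_mul]
    set e := Real.exp (-(z.im - s.im) ^ 2)
    calc _ ≤ (C * (Real.log T + u)) * (Real.exp 4 * e) := by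
          gcongr
          exact h1.trans (by gcongr)
      _ = Real.exp 4 * C * (Real.log T * e + u * e) := by ring
      _ ≤ Real.exp 4 * C * (Real.log T * 1 + 1 / Real.log 2 * Real.log T) := by
          apply mul_le_mul_of_nonneg_left _ (by positivity)
          have h7 : Real.log T * e ≤ Real.log T * 1 := by gcongr
          linarith
      _ = Real.exp 4 * C * (1 / Real.log 2 + 1) * Real.log T := by ring
      _ ≤ C1 * Real.log T := by
          gcongr; rw [hC1]; have : 0 < b / Real.log 2 := by positivity
          linarith
  have hdiff : ∀ z : ℂ, 1 / 2 < z.re → DifferentiableAt ℂ f z := by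
    intro z hz
    have h1 := DirichletCharacter.differentiable_LFunction hχ
    have h2 : Differentiable ℂ (deriv χ.LFunction) := fun z => (h1.analyticAt z).deriv.differentiableAt
    have h3 := hGRH.LFunction_ne_zero hχ hz
    rw [hf]
    exact ((h2 z).div (h1 z) h3).mul (by fun_prop)
  have hlu : 1 / 2 + δ < 2 := by linarith
  have h3l := Complex.HadamardThreeLines.norm_le_interp_of_mem_verticalClosedStrip' (f := f) (z := s)
    (a := C1 * Real.log T) (b := b) hlu ⟨by linarith, hs2⟩ ?_ ?_ ?_ ?_
  · have hfs : ‖f s‖ = ‖deriv χ.LFunction s / χ.LFunction s‖ * ‖Complex.exp ((s - s.im * I) ^ 2)‖ := by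
      rw [hf, norm_mul]
    have hs' : s - s.im * I = (s.re : ℂ) := by
      apply Complex.ext <;> simp
    have h1 : 1 ≤ ‖Complex.exp ((s - s.im * I) ^ 2)‖ := by
      rw [hs', Complex.norm_exp]
      apply Real.one_le_exp
      norm_cast
      positivity
    have h2 : ‖deriv χ.LFunction s / χ.LFunction s‖ ≤ ‖f s‖ := by
      rw [hfs]; exact le_mul_of_one_le_right (norm_nonneg _) h1
    refine h2.trans (h3l.trans ?_)
    set p := (s.re - (1 / 2 + δ)) / (2 - (1 / 2 + δ)) with hp
    have hpκ : κ ≤ p := by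
      have e : (2 - (1 / 2 + δ)) = 3 / 2 - δ := by ring
      rw [hκ, hp, e]
      gcongr
      · linarith
      · linarith
    have hba : b ≤ C1 * Real.log T := by
      calc b = b / Real.log 2 * Real.log 2 := by field_simp
        _ ≤ C1 * Real.log T := by
          gcongr
          rw [hC1]
          have : 0 < Real.exp 4 * C * (1 / Real.log 2 + 1) := by positivity
          linarith
    have ha : 0 < C1 * Real.log T := by positivity
    have e1 : (C1 * Real.log T) ^ (1 - p) * b ^ p =
        (C1 * Real.log T) ^ (1 - κ) * b ^ κ * (b / (C1 * Real.log T)) ^ (p - κ) := by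
      rw [Real.div_rpow hb1.le ha.le, show 1 - κ = (1 - p) + (p - κ) by ring, Real.rpow_add ha,
        Real.rpow_sub hb1]
      have := Real.rpow_pos_of_pos ha (p - κ)
      have := Real.rpow_pos_of_pos hb1 κ
      field_simp
    have e2 : (b / (C1 * Real.log T)) ^ (p - κ) ≤ 1 :=
      Real.rpow_le_one (by positivity) ((div_le_one ha).2 hba) (by linarith)
    rw [e1]
    calc _ ≤ (C1 * Real.log T) ^ (1 - κ) * b ^ κ * 1 := by gcongr
      _ = _ := by rw [Real.mul_rpow hC1p.le hlT0.le]; ring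
  · refine DifferentiableOn.diffContOnCl fun z hz => ?_
    have hcl : closure (HadamardThreeLines.verticalStrip (1 / 2 + δ) 2) ⊆
        {z : ℂ | 1 / 2 + δ ≤ z.re} := by
      refine closure_minimal (fun z hz => hz.1.le) (isClosed_le continuous_const continuous_re)
    have := hcl hz
    exact (hdiff z (by simp at this; linarith)).differentiableWithinAt
  · refine ⟨C1 * Real.log T, ?_⟩
    rintro _ ⟨z, hz, rfl⟩
    exact hbd z hz.1 hz.2
  · intro z hz
    have hz' : z.re = 1 / 2 + δ := by simpa using hz
    exact hbd z hz'.ge (by linarith)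
  · intro z hz
    have hz' : z.re = 2 := by simpa using hz
    rw [hf, norm_mul, hb, mul_comm]
    have h2 := norm_exp_sub_sq_le (s := z) (t := s.im) (by linarith) hz'.le
    have h5 : Real.exp (-(z.im - s.im) ^ 2) ≤ 1 := Real.exp_le_one_iff.2 (by nlinarith)
    have h6 := (hZ N χ z hz').2.2
    have h7 : ‖Complex.exp ((z - s.im * I) ^ 2)‖ ≤ Real.exp 4 :=
      h2.trans (mul_le_of_le_one_right (Real.exp_pos _).le h5)
    gcongr

/-- The Lindelöf hypothesis in the conductor and `t` aspects, as a consequence of GRH. -/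
theorem GRH.norm_LFunction_le_rpow (hGRH : GRH) {δ ε : ℝ} (hδ : 0 < δ) (hδ' : δ < 1 / 2)
    (hε : 0 < ε) :
    ∃ C : ℝ, 1 ≤ C ∧ ∀ (N : ℕ) [NeZero N] (χ : DirichletCharacter ℂ N), χ ≠ 1 →
      ∀ s : ℂ, 1 / 2 + 2 * δ ≤ s.re → s.re ≤ 2 →
      ‖χ.LFunction s‖ ≤ C * (N * (|s.im| + 2)) ^ ε := by
  obtain ⟨C, κ, hC, hκ0, hκ1, hlog⟩ := hGRH.norm_logDeriv_le_log_rpow hδ hδ'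
  obtain ⟨Z, hZ1, hZ⟩ := exists_bound_LFunction_re_two
  set B := (2 * C / ε) ^ (1 / κ) with hB
  have hB0 : 0 < B := by positivity
  set D := C * B ^ (1 - κ) with hD
  have hD0 : 0 < D := by positivity
  refine ⟨Z * Real.exp (2 * D), ?_, fun N _ χ hχ s hs1 hs2 => ?_⟩
  · have := Real.one_le_exp (show 0 ≤ 2 * D by positivity)
    nlinarith
  set T : ℝ := N * (|s.im| + 2) with hT
  have hT2 : 2 ≤ T := two_le_conductor_mul _
  have hlT0 : 0 < Real.log T := Real.log_pos (by linarith)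
  set K := C * (Real.log T) ^ (1 - κ) with hK
  have hK0 : 0 < K := by positivity
  have hKle : K ≤ D + ε / 2 * Real.log T := by
    rcases le_or_gt (Real.log T) B with h | h
    · have : K ≤ D := by
        rw [hK, hD]; gcongr
      have : 0 < ε / 2 * Real.log T := by positivity
      linarith
    · have h1 : 2 * C / ε ≤ (Real.log T) ^ κ := by
        have : 2 * C / ε = B ^ κ := by
          rw [hB, ← Real.rpow_mul (by positivity), one_div_mul_cancel hκ0.ne', Real.rpow_one]
        rw [this]; gcongr
      have h2 : C ≤ ε / 2 * (Real.log T) ^ κ := by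
        rw [div_le_iff₀ hε] at h1; linarith
      calc K ≤ ε / 2 * (Real.log T) ^ κ * (Real.log T) ^ (1 - κ) := by rw [hK]; gcongr
        _ = ε / 2 * Real.log T := by
          rw [mul_assoc, ← Real.rpow_add hlT0]; simp
        _ ≤ _ := by linarith
  set f : ℝ → ℂ := fun u => χ.LFunction ((2 - u : ℝ) + s.im * I) with hf
  have hfd : ∀ u : ℝ, HasDerivAt f (-deriv χ.LFunction ((2 - u : ℝ) + s.im * I)) u := by
    intro u
    have h1 := ((DirichletCharacter.differentiable_LFunction hχ) ((2 - u : ℝ) + s.im * I)).hasDerivAt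
    have h2 : HasDerivAt (fun u : ℝ => ((2 - u : ℝ) : ℂ) + s.im * I) (-1) u := by
      have := (((hasDerivAt_id u).const_sub 2).ofReal_comp).add_const (s.im * I)
      simpa using this
    exact (h1.comp u h2).congr_deriv (mul_neg_one _)
  have hgr := norm_le_gronwallBound_of_norm_deriv_right_le (f := f) (δ := Z) (K := K) (ε := 0)
    (a := 0) (b := 2 - s.re) (f' := fun u => -deriv χ.LFunction ((2 - u : ℝ) + s.im * I))
    (fun u _ => (hfd u).continuousAt.continuousWithinAt)
    (fun u _ => (hfd u).hasDerivWithinAt) ?_ ?_ (2 - s.re) ⟨by linarith, le_rfl⟩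
  · rw [gronwallBound_ε0] at hgr
    have e1 : f (2 - s.re) = χ.LFunction s := by
      rw [hf]
      apply Complex.ext <;> simp
    rw [e1] at hgr
    refine hgr.trans ?_
    calc Z * Real.exp (K * (2 - s.re - 0)) ≤ Z * Real.exp (2 * D + Real.log T * ε) := by
          gcongr
          nlinarith
      _ = _ := by
          rw [Real.rpow_def_of_pos (by linarith), Real.exp_add, mul_assoc]
  · have := (hZ N χ ((2 - (0 : ℝ) : ℝ) + s.im * I) (by simp)).1
    exact this
  · intro u hu
    have h1 : (((2 - u : ℝ) : ℂ) + s.im * I).re = 2 - u := by simp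
    have h2 : (((2 - u : ℝ) : ℂ) + s.im * I).im = s.im := by simp
    have hu1 := hu.1
    have hu2 := hu.2
    have h3 := hlog N χ hχ ((2 - u : ℝ) + s.im * I) (by rw [h1]; linarith) (by rw [h1]; linarith)
    have h4 : χ.LFunction ((2 - u : ℝ) + s.im * I) ≠ 0 :=
      hGRH.LFunction_ne_zero hχ (by rw [h1]; linarith)
    rw [h2, norm_div, div_le_iff₀ (norm_pos_iff.2 h4)] at h3
    rw [norm_neg, add_zero]
    exact h3

end Lindelof

section Divisors

/-- The divisor bound. -/
lemma exists_card_divisors_le_rpow {ε : ℝ} (hε : 0 < ε) :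
    ∃ C : ℝ, 1 ≤ C ∧ ∀ n : ℕ, n ≠ 0 → (n.divisors.card : ℝ) ≤ C * (n : ℝ) ^ ε := by
  have hl2 : 0 < Real.log 2 := Real.log_pos one_lt_two
  set K : ℝ := 1 + 1 / (ε * Real.log 2) with hK
  have hK1 : 1 ≤ K := by rw [hK]; have : 0 < 1 / (ε * Real.log 2) := by positivity
                         linarith
  set P : ℕ := ⌈(2 : ℝ) ^ (1 / ε)⌉₊ with hP
  refine ⟨K ^ P, one_le_pow₀ hK1, fun n hn => ?_⟩
  rw [Nat.card_divisors hn]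
  have hprime : ∀ p ∈ n.primeFactors, ((n.factorization p + 1 : ℕ) : ℝ) ≤
      (if p < P then K else 1) * ((p : ℝ) ^ (n.factorization p)) ^ ε := by
    intro p hp
    set a := n.factorization p
    have hp2 : (2 : ℝ) ≤ p := by exact_mod_cast (Nat.prime_of_mem_primeFactors hp).two_le
    have hcomm : ((p : ℝ) ^ a) ^ ε = ((p : ℝ) ^ ε) ^ a := by
      rw [← Real.rpow_natCast, ← Real.rpow_natCast, ← Real.rpow_mul (by positivity),
        ← Real.rpow_mul (by positivity), mul_comm]
    split_ifs with h
    · have h1 : (2 : ℝ) ^ (a * ε) ≤ ((p : ℝ) ^ a) ^ ε := by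
        rw [Real.rpow_mul (by norm_num), Real.rpow_natCast]; gcongr
      have h2 : 1 + ε * Real.log 2 * a ≤ (2 : ℝ) ^ (a * ε) := by
        rw [Real.rpow_def_of_pos two_pos]
        have := Real.add_one_le_exp (Real.log 2 * (a * ε))
        linarith
      calc ((a + 1 : ℕ) : ℝ) = 1 + a := by push_cast; ring
        _ ≤ K * (1 + ε * Real.log 2 * a) := by
          have : K * (1 + ε * Real.log 2 * a) = 1 + a + (1 / (ε * Real.log 2) + ε * Real.log 2 * a) := by
            rw [hK]; field_simp; ring
          rw [this]
          have : 0 ≤ 1 / (ε * Real.log 2) + ε * Real.log 2 * a := by positivity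
          linarith
        _ ≤ _ := by gcongr; exact h2.trans h1
    · have h1 : (2 : ℝ) ≤ (p : ℝ) ^ ε := by
        have h3 : (2 : ℝ) ^ (1 / ε) ≤ p := (Nat.le_ceil _).trans (by exact_mod_cast not_lt.1 h)
        calc (2 : ℝ) = ((2 : ℝ) ^ (1 / ε)) ^ ε := by
              rw [← Real.rpow_mul (by norm_num), one_div_mul_cancel hε.ne', Real.rpow_one]
          _ ≤ _ := by gcongr
      rw [one_mul, hcomm]
      calc ((a + 1 : ℕ) : ℝ) ≤ (2 : ℝ) ^ a := by exact_mod_cast Nat.lt_two_pow_self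
        _ ≤ _ := by gcongr
  calc ((∏ x ∈ n.primeFactors, (n.factorization x + 1) : ℕ) : ℝ)
      = ∏ x ∈ n.primeFactors, ((n.factorization x + 1 : ℕ) : ℝ) := by push_cast; rfl
    _ ≤ ∏ p ∈ n.primeFactors, ((if p < P then K else 1) * ((p : ℝ) ^ (n.factorization p)) ^ ε) :=
        Finset.prod_le_prod (fun _ _ => by positivity) hprime
    _ = (∏ p ∈ n.primeFactors, (if p < P then K else 1)) * (n : ℝ) ^ ε := by
        rw [Finset.prod_mul_distrib, Real.finsetProd_rpow _ _ (fun _ _ => by positivity)]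
        congr 2
        conv_rhs => rw [← Nat.prod_factorization_pow_eq_self hn]
        rw [Finsupp.prod]; push_cast; rfl
    _ ≤ K ^ P * (n : ℝ) ^ ε := by
        gcongr
        rw [← Finset.prod_filter]
        rw [Finset.prod_const]
        apply pow_le_pow_right₀ hK1
        calc _ ≤ (Finset.range P).card := Finset.card_le_card (fun x hx => by
              simp at hx ⊢; exact hx.2)
          _ = P := Finset.card_range P

end Divisors

section GeneralizedDivisor

lemma dk_zero_left (n : ℕ) : dk 0 n = if n = 1 then 1 else 0 := by
  unfold dk
  split_ifs with h
  · subst h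
    simp
  · have : IsEmpty {f : Fin 0 → ℕ // (∀ i, 0 < f i) ∧ ∏ i, f i = n} :=
      ⟨fun f => h (by have := f.2.2; simpa using this.symm)⟩
    exact Nat.card_of_isEmpty

lemma finite_factorizations (k n : ℕ) :
    Finite {f : Fin k → ℕ // (∀ i, 0 < f i) ∧ ∏ i, f i = n} := by
  have h : {f : Fin k → ℕ | (∀ i, 0 < f i) ∧ ∏ i, f i = n} ⊆
      Set.pi Set.univ (fun _ => Set.Iic n) := by
    rintro f ⟨hf, rfl⟩ i -
    exact Nat.le_of_dvd (Finset.prod_pos fun i _ => hf i) (Finset.dvd_prod_of_mem f (Finset.mem_univ i))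
  exact ((Set.Finite.pi fun _ => Set.finite_Iic n).subset h).to_subtype

lemma dk_succ (k n : ℕ) (hn : n ≠ 0) :
    dk (k + 1) n = ∑ d ∈ n.divisors, dk k (n / d) := by
  let e : {f : Fin (k + 1) → ℕ // (∀ i, 0 < f i) ∧ ∏ i, f i = n} ≃
      (Σ d : n.divisors, {f : Fin k → ℕ // (∀ i, 0 < f i) ∧ ∏ i, f i = n / (d : ℕ)}) :=
    { toFun := fun f => ⟨⟨f.1 0, by
          rw [Nat.mem_divisors]
          exact ⟨⟨_, (Fin.prod_univ_succ f.1 ▸ f.2.2).symm⟩, hn⟩⟩,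
        ⟨fun i => f.1 i.succ, fun i => f.2.1 _, by
          have := Fin.prod_univ_succ f.1 ▸ f.2.2
          exact (Nat.div_eq_of_eq_mul_right (f.2.1 0) this.symm).symm⟩⟩
      invFun := fun p => ⟨Fin.cons p.1.1 p.2.1, by
          refine ⟨fun i => ?_, ?_⟩
          · refine Fin.cases ?_ (fun j => ?_) i
            · simpa using Nat.pos_of_mem_divisors p.1.2
            · simpa using p.2.2.1 j
          · rw [Fin.prod_univ_succ]
            simp only [Fin.cons_zero, Fin.cons_succ]
            rw [p.2.2.2, Nat.mul_div_cancel' (Nat.dvd_of_mem_divisors p.1.2)]⟩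
      left_inv := fun f => by
        apply Subtype.ext
        exact Fin.cons_self_tail f.1
      right_inv := fun p => by
        rcases p with ⟨⟨d, hd⟩, ⟨f, hf⟩⟩
        rfl }
  have hfin := fun d : n.divisors => finite_factorizations k (n / (d : ℕ))
  unfold dk
  rw [Nat.card_congr e, Nat.card_sigma]
  exact (Finset.sum_coe_sort n.divisors
    (fun d => Nat.card {f : Fin k → ℕ // (∀ i, 0 < f i) ∧ ∏ i, f i = n / d}))

/-- A recursion for `d_k` at multiples of `c`, organized as a sum of coprime convolutions. -/
lemma dk_succ_mul (k : ℕ) {c M : ℕ} (hc : c ≠ 0) (hM : M ≠ 0) :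
    dk (k + 1) (c * M) = ∑ e ∈ c.divisors, ∑ b ∈ M.divisors,
      if Nat.Coprime b e then dk k (e * (M / b)) else 0 := by
  rw [dk_succ _ _ (mul_ne_zero hc hM)]
  simp_rw [← Finset.sum_filter]
  rw [Finset.sum_sigma']
  refine Finset.sum_bij' (fun a _ => ⟨c / Nat.gcd a c, a / Nat.gcd a c⟩)
    (fun p _ => c / p.1 * p.2) ?_ ?_ ?_ ?_ ?_
  · intro a ha
    have hadvd := Nat.dvd_of_mem_divisors ha
    have hg : 0 < Nat.gcd a c := Nat.gcd_pos_of_pos_right _ (Nat.pos_of_ne_zero hc)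
    have hcop : Nat.Coprime (a / Nat.gcd a c) (c / Nat.gcd a c) := Nat.coprime_div_gcd_div_gcd hg
    simp only [Finset.mem_sigma, Finset.mem_filter, Nat.mem_divisors]
    refine ⟨⟨Nat.div_dvd_of_dvd (Nat.gcd_dvd_right a c), hc⟩, ⟨?_, hM⟩, hcop⟩
    refine hcop.dvd_of_dvd_mul_left (?_ : _ ∣ c / Nat.gcd a c * M)
    have h1 : a / Nat.gcd a c * Nat.gcd a c ∣ (c / Nat.gcd a c * M) * Nat.gcd a c := by
      rw [Nat.div_mul_cancel (Nat.gcd_dvd_left a c), mul_right_comm,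
        Nat.div_mul_cancel (Nat.gcd_dvd_right a c)]
      exact hadvd
    exact Nat.dvd_of_mul_dvd_mul_right hg h1
  · rintro ⟨e, b⟩ h
    simp only [Finset.mem_sigma, Finset.mem_filter, Nat.mem_divisors] at h
    rw [Nat.mem_divisors]
    exact ⟨mul_dvd_mul (Nat.div_dvd_of_dvd h.1.1) h.2.1.1, mul_ne_zero hc hM⟩
  · intro a ha
    have hg : 0 < Nat.gcd a c := Nat.gcd_pos_of_pos_right _ (Nat.pos_of_ne_zero hc)
    simp only
    rw [Nat.div_div_self (Nat.gcd_dvd_right a c) hc, Nat.mul_div_cancel' (Nat.gcd_dvd_left a c)]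
  · rintro ⟨e, b⟩ h
    simp only [Finset.mem_sigma, Finset.mem_filter, Nat.mem_divisors] at h
    obtain ⟨⟨⟨f, rfl⟩, -⟩, ⟨hb, -⟩, hcop⟩ := h
    have he : 0 < e := Nat.pos_of_ne_zero (left_ne_zero_of_mul hc)
    have hf : 0 < f := Nat.pos_of_ne_zero (right_ne_zero_of_mul hc)
    have hg : Nat.gcd (e * f / e * b) (e * f) = f := by
      rw [Nat.mul_div_cancel_left _ he, mul_comm e f, Nat.gcd_mul_left, hcop, mul_one]
    simp only [hg]
    rw [Nat.mul_div_cancel _ hf, Nat.mul_div_cancel_left _ he, Nat.mul_div_cancel_left _ hf]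
  · intro a ha
    have hadvd := Nat.dvd_of_mem_divisors ha
    have ha0 : 0 < a := Nat.pos_of_mem_divisors ha
    have hg : 0 < Nat.gcd a c := Nat.gcd_pos_of_pos_right _ (Nat.pos_of_ne_zero hc)
    have hcop : Nat.Coprime (a / Nat.gcd a c) (c / Nat.gcd a c) := Nat.coprime_div_gcd_div_gcd hg
    simp only
    obtain ⟨g, a', c', hg', ha', hcc, hg''⟩ : ∃ g a' c' : ℕ, 0 < g ∧ a = g * a' ∧ c = g * c' ∧
        Nat.gcd a c = g := ⟨Nat.gcd a c, a / Nat.gcd a c, c / Nat.gcd a c, hg,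
          (Nat.mul_div_cancel' (Nat.gcd_dvd_left a c)).symm,
          (Nat.mul_div_cancel' (Nat.gcd_dvd_right a c)).symm, rfl⟩
    rw [hg''] at hcop ⊢
    subst ha' hcc
    rw [Nat.mul_div_cancel_left _ hg', Nat.mul_div_cancel_left _ hg'] at *
    have hdvd : a' ∣ M := by
      refine hcop.dvd_of_dvd_mul_left (?_ : _ ∣ c' * M)
      rw [mul_assoc] at hadvd
      exact Nat.dvd_of_mul_dvd_mul_left hg' hadvd
    congr 1
    rw [mul_assoc, Nat.mul_div_mul_left _ _ hg', Nat.mul_div_assoc _ hdvd]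

end GeneralizedDivisor

section TwistedSeries

lemma changeLevel_mul_apply_natCast {q e : ℕ} [NeZero q] [NeZero e] (χ : DirichletCharacter ℂ q)
    (n : ℕ) : DirichletCharacter.changeLevel (Dvd.intro e rfl : q ∣ q * e) χ (n : ZMod (q * e)) =
      if n.Coprime e then χ n else 0 := by
  by_cases hq : n.Coprime (q * e)
  · have he : n.Coprime e := hq.coprime_mul_left_right
    rw [if_pos he]
    have := DirichletCharacter.changeLevel_eq_cast_of_dvd' χ (Dvd.intro e rfl : q ∣ q * e)
      (a := (n : ℤ)) (by exact_mod_cast Nat.isCoprime_iff_coprime.2 hq)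
    simpa using this
  · rw [MulChar.map_nonunit _ (by rwa [ZMod.isUnit_iff_coprime])]
    split_ifs with he
    · rw [MulChar.map_nonunit]
      rw [ZMod.isUnit_iff_coprime]
      exact fun h => hq (Nat.Coprime.mul_right h he)
    · rfl

/-- The Dirichlet series of `M ↦ d_k(cM) χ(M)` extends to an entire function which inherits
bounds of Lindelöf type from those of the Dirichlet `L`-functions. -/
lemma exists_entire_extension_dk_mul {C ε σ : ℝ} (hC : 1 ≤ C) (hε : 0 < ε)
    (H : ∀ (N : ℕ) [NeZero N] (χ : DirichletCharacter ℂ N), χ ≠ 1 → ∀ s : ℂ, σ ≤ s.re →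
      s.re ≤ 2 → ‖χ.LFunction s‖ ≤ C * ((N : ℝ) * (|s.im| + 2)) ^ ε)
    {q : ℕ} [NeZero q] {χ : DirichletCharacter ℂ q} (hχ : χ ≠ 1) (k : ℕ) :
    ∀ c : ℕ, c ≠ 0 → ∃ D : ℂ → ℂ, Differentiable ℂ D ∧
      (∀ s : ℂ, 1 < s.re → LSeriesHasSum (fun n => (dk k (c * n) : ℂ) * χ n) s (D s)) ∧
      ∀ s : ℂ, σ ≤ s.re → s.re ≤ 2 →
        ‖D s‖ ≤ (c.divisors.card * (C * ((q : ℝ) * c * (|s.im| + 2)) ^ ε)) ^ k := by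
  have hq1 : (1 : ℝ) ≤ q := by exact_mod_cast Nat.pos_of_ne_zero (NeZero.ne q)
  have hL : ∀ e : ℕ, e ≠ 0 → ∃ l : ℂ → ℂ, Differentiable ℂ l ∧
      (∀ s : ℂ, 1 < s.re → LSeriesHasSum (fun n => if n.Coprime e then χ n else 0) s (l s)) ∧
      ∀ s : ℂ, σ ≤ s.re → s.re ≤ 2 → ‖l s‖ ≤ C * ((q : ℝ) * e * (|s.im| + 2)) ^ ε := by
    intro e he
    have : NeZero e := ⟨he⟩
    set ψ := DirichletCharacter.changeLevel (Dvd.intro e rfl : q ∣ q * e) χ with hψ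
    have hψ1 : ψ ≠ 1 := fun h => hχ ((DirichletCharacter.changeLevel_eq_one_iff _).1 h)
    refine ⟨ψ.LFunction, DirichletCharacter.differentiable_LFunction hψ1, fun s hs => ?_,
      fun s h1 h2 => ?_⟩
    · have h := (ZMod.LSeriesSummable_of_one_lt_re ψ hs).LSeriesHasSum
      rw [← DirichletCharacter.LFunction_eq_LSeries _ hs] at h
      convert h using 2 with n
      exact (changeLevel_mul_apply_natCast χ n).symm
    · simpa using H (q * e) ψ hψ1 s h1 h2
  choose! l hld hls hlb using hL
  induction k with
  | zero =>
    intro c hc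
    refine ⟨fun _ => if c = 1 then 1 else 0, differentiable_const _, fun s hs => ?_,
      fun s _ _ => ?_⟩
    · by_cases h1 : c = 1
      · subst h1
        have e : (fun n : ℕ => (dk 0 (1 * n) : ℂ) * χ n) = LSeries.delta := by
          ext n
          rw [dk_zero_left, one_mul, LSeries.delta]
          split_ifs with h
          · simp [h]
          · simp
        have hs : LSeriesSummable LSeries.delta s :=
          LSeriesSummable_of_isBigO_rpow (x := 1) hs (by
            refine Asymptotics.IsBigO.of_bound 1 (Filter.Eventually.of_forall fun n => ?_)
            simp only [LSeries.delta]
            split_ifs <;> simp)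
        rw [e]
        simpa [LSeries_delta] using hs.LSeriesHasSum
      · have e : (fun n : ℕ => (dk 0 (c * n) : ℂ) * χ n) = 0 := by
          ext n
          rw [dk_zero_left, if_neg (fun h => h1 (Nat.eq_one_of_mul_eq_one_right h))]
          simp
        rw [e, if_neg h1]
        simpa using (LSeriesSummable_zero (s := s)).LSeriesHasSum
    · split_ifs <;> simp
  | succ k ih =>
    intro c hc
    choose! D hDd hDs hDb using ih
    have hne : ∀ e ∈ c.divisors, e ≠ 0 := fun e he => (Nat.pos_of_mem_divisors he).ne'
    refine ⟨fun s => ∑ e ∈ c.divisors, l e s * D e s, ?_, fun s hs => ?_, fun s h1 h2 => ?_⟩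
    · exact Differentiable.fun_sum fun e he => (hld e (hne e he)).mul (hDd e (hne e he))
    · have h := LSeriesHasSum.sum (S := c.divisors) fun e he =>
        (hls e (hne e he) s hs).convolution (hDs e (hne e he) s hs)
      refine (LSeriesHasSum_congr s _ fun {M} hM => ?_).1 h
      rw [Finset.sum_apply, dk_succ_mul k hc hM]
      push_cast
      rw [Finset.sum_mul]
      refine Finset.sum_congr rfl fun e he => ?_
      rw [LSeries.convolution_def]
      simp only
      rw [Nat.sum_divisorsAntidiagonal (fun i j : ℕ =>
        (if i.Coprime e then χ i else 0) * ((dk k (e * j) : ℂ) * χ j)), Finset.sum_mul]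
      refine Finset.sum_congr rfl fun b hb => ?_
      have hbM : χ (M : ZMod q) = χ (b : ZMod q) * χ ((M / b : ℕ) : ZMod q) := by
        rw [← map_mul, ← Nat.cast_mul, Nat.mul_div_cancel' (Nat.dvd_of_mem_divisors hb)]
      split_ifs
      · rw [hbM]; ring
      · simp
    · have hT : 0 ≤ |s.im| + 2 := by positivity
      have hc1 : (0 : ℝ) ≤ c := by positivity
      have hmono : ∀ e ∈ c.divisors, C * ((q : ℝ) * e * (|s.im| + 2)) ^ ε ≤
          C * ((q : ℝ) * c * (|s.im| + 2)) ^ ε := fun e he => by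
        have : (e : ℝ) ≤ c := by exact_mod_cast Nat.divisor_le he
        gcongr
      calc ‖∑ e ∈ c.divisors, l e s * D e s‖
          ≤ ∑ e ∈ c.divisors, (C * ((q : ℝ) * c * (|s.im| + 2)) ^ ε) *
              (c.divisors.card * (C * ((q : ℝ) * c * (|s.im| + 2)) ^ ε)) ^ k := by
            refine norm_sum_le_of_le _ fun e he => ?_
            rw [norm_mul]
            have h3 : (e.divisors.card : ℝ) ≤ c.divisors.card := by
              exact_mod_cast Finset.card_le_card
                (Nat.divisors_subset_of_dvd hc (Nat.dvd_of_mem_divisors he))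
            refine mul_le_mul ((hlb e (hne e he) s h1 h2).trans (hmono e he))
              ((hDb e (hne e he) s h1 h2).trans ?_) (norm_nonneg _) (by positivity)
            refine pow_le_pow_left₀ (by positivity) ?_ _
            exact mul_le_mul h3 (hmono e he) (by positivity) (by positivity)
        _ = _ := by
            rw [Finset.sum_const, nsmul_eq_mul, pow_succ]
            ring

end TwistedSeries

section MellinBounds

open Set

/-- `f` is a `C²` function supported in `[u₀, u₁]`, with derivatives `f'` and `f''`. -/
structure IsC2SupportedOn (u₀ u₁ : ℝ) (f f' f'' : ℝ → ℂ) : Prop where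
  hasDerivAt : ∀ u, HasDerivAt f (f' u) u
  hasDerivAt' : ∀ u, HasDerivAt f' (f'' u) u
  continuous'' : Continuous f''
  eq_zero : ∀ u, u ∉ Ioo u₀ u₁ → f u = 0
  eq_zero' : ∀ u, u ∉ Ioo u₀ u₁ → f' u = 0
  eq_zero'' : ∀ u, u ∉ Ioo u₀ u₁ → f'' u = 0

namespace IsC2SupportedOn

variable {u₀ u₁ : ℝ} {f f' f'' : ℝ → ℂ}

lemma continuous (h : IsC2SupportedOn u₀ u₁ f f' f'') : Continuous f :=
  continuous_iff_continuousAt.2 fun u => (h.hasDerivAt u).continuousAt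

lemma continuous' (h : IsC2SupportedOn u₀ u₁ f f' f'') : Continuous f' :=
  continuous_iff_continuousAt.2 fun u => (h.hasDerivAt' u).continuousAt

lemma mellin_eq (h : IsC2SupportedOn u₀ u₁ f f' f'') (h₀ : 0 < u₀) (h₁ : u₀ < u₁) (s : ℂ) :
    mellin f s = ∫ t in u₀..u₁, (t : ℂ) ^ (s - 1) * f t := by
  rw [mellin, intervalIntegral.integral_of_le h₁.le]
  refine setIntegral_eq_of_subset_of_forall_sdiff_eq_zero measurableSet_Ioi
    (fun t ht => h₀.trans ht.1) fun t ht => ?_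
  rw [h.eq_zero t (fun h' => ht.2 ⟨h'.1, h'.2.le⟩), smul_zero]

lemma isBigO_atTop (h : IsC2SupportedOn u₀ u₁ f f' f'') (a : ℝ) :
    f =O[Filter.atTop] (fun t : ℝ => t ^ (-a)) := by
  refine Asymptotics.IsBigO.of_bound 1 ?_
  filter_upwards [Filter.eventually_ge_atTop u₁, Filter.eventually_ge_atTop 0] with t ht ht0
  rw [h.eq_zero t (fun h' => h'.2.not_ge ht), norm_zero]
  positivity

lemma isBigO_nhdsWithin_zero (h : IsC2SupportedOn u₀ u₁ f f' f'') (h₀ : 0 < u₀) (b : ℝ) :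
    f =O[nhdsWithin 0 (Ioi 0)] (fun t : ℝ => t ^ (-b)) := by
  refine Asymptotics.IsBigO.of_bound 1 ?_
  filter_upwards [Ioo_mem_nhdsGT h₀] with t ht
  rw [h.eq_zero t (fun h' => h'.1.not_gt ht.2), norm_zero]
  positivity

lemma mellinConvergent (h : IsC2SupportedOn u₀ u₁ f f' f'') (h₀ : 0 < u₀) (s : ℂ) :
    MellinConvergent f s :=
  mellinConvergent_of_isBigO_rpow (h.continuous.continuousOn.locallyIntegrableOn measurableSet_Ioi)
    (h.isBigO_atTop _) (lt_add_one s.re) (h.isBigO_nhdsWithin_zero h₀ _) (sub_one_lt s.re)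

lemma differentiable_mellin (h : IsC2SupportedOn u₀ u₁ f f' f'') (h₀ : 0 < u₀) :
    Differentiable ℂ (mellin f) := fun s =>
  mellin_differentiableAt_of_isBigO_rpow
    (h.continuous.continuousOn.locallyIntegrableOn measurableSet_Ioi)
    (h.isBigO_atTop _) (lt_add_one s.re) (h.isBigO_nhdsWithin_zero h₀ _) (sub_one_lt s.re)

lemma mellin_mul (h : IsC2SupportedOn u₀ u₁ f f' f'') (h₀ : 0 < u₀) (h₁ : u₀ < u₁) {s : ℂ}
    (hs : 0 < s.re) :
    mellin f s * (s * (s + 1)) = ∫ t in u₀..u₁, (t : ℂ) ^ (s + 1) * f'' t := by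
  have key : ∀ (g g' : ℝ → ℂ) (w : ℂ), 0 < w.re → (∀ u, HasDerivAt g (g' u) u) →
      Continuous g → Continuous g' →
      (∀ u, u ∉ Ioo u₀ u₁ → g u = 0) → (∫ t in u₀..u₁, (t : ℂ) ^ (w - 1) * g t) * w =
        - ∫ t in u₀..u₁, (t : ℂ) ^ w * g' t := by
    intro g g' w hw hg hgc hg'c hg0
    have hw0 : w ≠ 0 := fun e => by simp [e] at hw
    have hv : ∀ x ∈ uIcc u₀ u₁, HasDerivAt (fun t : ℝ => (t : ℂ) ^ w) (w * (x : ℂ) ^ (w - 1)) x := by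
      intro x hx
      rw [uIcc_of_le h₁.le] at hx
      exact hasDerivAt_ofReal_cpow_const (h₀.trans_le hx.1).ne' hw0
    have hc : ∀ v : ℂ, ContinuousOn (fun t : ℝ => (t : ℂ) ^ v) (uIcc u₀ u₁) := fun v x hx => by
      rw [uIcc_of_le h₁.le] at hx
      exact (Complex.continuousAt_ofReal_cpow_const x v (Or.inr (h₀.trans_le hx.1).ne')).continuousWithinAt
    have := intervalIntegral.integral_mul_deriv_eq_deriv_mul (u := g) (u' := g')
      (a := u₀) (b := u₁) (fun x _ => hg x) hv
      (hg'c.intervalIntegrable _ _) ((continuousOn_const.mul (hc _)).intervalIntegrable)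
    rw [hg0 u₀ (by simp), hg0 u₁ (by simp)] at this
    simp only [zero_mul, sub_zero, zero_sub] at this
    rw [← intervalIntegral.integral_mul_const]
    convert this using 1
    · congr 1; ext t; ring
    · congr 2; ext t; ring
  have e1 := key f f' s hs h.hasDerivAt h.continuous h.continuous' h.eq_zero
  have e2 := key f' f'' (s + 1) (by simp; linarith) h.hasDerivAt' h.continuous' h.continuous''
    h.eq_zero'
  rw [add_sub_cancel_right] at e2
  rw [h.mellin_eq h₀ h₁, ← mul_assoc, e1, neg_mul, e2, neg_neg]

end IsC2SupportedOn

/-- Decay of Mellin transforms of `C²` functions with fixed compact support in `(0, ∞)`. -/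
lemma exists_mellin_bound {u₀ u₁ : ℝ} (h₀ : 0 < u₀) (h₁ : u₀ < u₁) :
    ∃ K : ℝ, 1 ≤ K ∧ ∀ f f' f'' : ℝ → ℂ, IsC2SupportedOn u₀ u₁ f f' f'' → ∀ s : ℂ, 0 < s.re →
      s.re ≤ 2 → ∀ P : ℝ, (P ^ 2 + s.im ^ 2) * ‖mellin f s‖ ≤
        K * (P ^ 2 * (∫ t in u₀..u₁, ‖f t‖) + ∫ t in u₀..u₁, ‖f'' t‖) := by
  obtain ⟨K, hK⟩ := (isCompact_Icc.prod (isCompact_Icc (a := (-1 : ℝ)) (b := 3)) :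
    IsCompact (Icc u₀ u₁ ×ˢ Icc (-1 : ℝ) 3)).exists_bound_of_continuousOn
    (f := fun p : ℝ × ℝ => p.1 ^ p.2) (fun p hp => by
      have : 0 < p.1 := h₀.trans_le hp.1.1
      exact (ContinuousAt.rpow continuousAt_fst continuousAt_snd (Or.inl this.ne')).continuousWithinAt)
  refine ⟨max K 1, le_max_right _ _, fun f f' f'' h s hs hs2 P => ?_⟩
  have gen : ∀ (g : ℝ → ℂ) (w : ℂ), Continuous g → -1 ≤ w.re → w.re ≤ 3 →
      ‖∫ t in u₀..u₁, (t : ℂ) ^ w * g t‖ ≤ max K 1 * ∫ t in u₀..u₁, ‖g t‖ := by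
    intro g w hg hw1 hw3
    rw [← intervalIntegral.integral_const_mul]
    refine intervalIntegral.norm_integral_le_of_norm_le h₁.le ?_
      ((hg.norm.const_mul _ ).intervalIntegrable _ _)
    refine Filter.Eventually.of_forall fun t ht => ?_
    have ht0 : 0 < t := h₀.trans ht.1
    rw [norm_mul, Complex.norm_cpow_eq_rpow_re_of_pos ht0]
    gcongr
    refine le_trans ?_ (le_max_left _ _)
    exact (le_abs_self _).trans (hK (t, w.re) ⟨⟨ht.1.le, ht.2⟩, hw1, hw3⟩)
  have b1 := gen f (s - 1) h.continuous (by simp; linarith) (by simp; linarith)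
  have b2 := gen f'' (s + 1) h.continuous'' (by simp; linarith) (by simp; linarith)
  rw [← h.mellin_eq h₀ h₁] at b1
  rw [← h.mellin_mul h₀ h₁ hs, norm_mul, norm_mul] at b2
  have i1 : |s.im| ≤ ‖s‖ := Complex.abs_im_le_norm s
  have i2 : |s.im| ≤ ‖s + 1‖ := by simpa using Complex.abs_im_le_norm (s + 1)
  have i3 : s.im ^ 2 ≤ ‖s‖ * ‖s + 1‖ := by
    rw [← sq_abs, sq]
    gcongr
  calc (P ^ 2 + s.im ^ 2) * ‖mellin f s‖
      ≤ P ^ 2 * ‖mellin f s‖ + ‖mellin f s‖ * (‖s‖ * ‖s + 1‖) := by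
        nlinarith [norm_nonneg (mellin f s)]
    _ ≤ P ^ 2 * (max K 1 * ∫ t in u₀..u₁, ‖f t‖) + max K 1 * ∫ t in u₀..u₁, ‖f'' t‖ := by
        gcongr
    _ = _ := by ring

end MellinBounds

section Perron

open Set Filter

lemma integrable_one_add_abs_rpow : Integrable fun y : ℝ => (1 + |y|) ^ (-(3 / 2) : ℝ) := by
  have := integrable_one_add_norm (E := ℝ) (μ := volume) (r := 3 / 2) (by norm_num)
  simpa using this

lemma tendsto_one_add_abs_rpow :
    Tendsto (fun y : ℝ => (1 + |y|) ^ (-(3 / 2) : ℝ)) atTop (nhds 0) :=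
  (tendsto_rpow_neg_atTop (by norm_num)).comp
    (tendsto_atTop_add_const_left _ _ tendsto_abs_atTop_atTop)

/-- Shifting a vertical line of integration. -/
lemma integral_vertical_eq {G : ℂ → ℂ} {σ₁ σ₂ A : ℝ} (hσ : σ₁ ≤ σ₂) (hG : Differentiable ℂ G)
    (hb : ∀ s : ℂ, σ₁ ≤ s.re → s.re ≤ σ₂ → ‖G s‖ ≤ A * (1 + |s.im|) ^ (-(3 / 2) : ℝ)) :
    ∫ y : ℝ, G (σ₁ + y * I) = ∫ y : ℝ, G (σ₂ + y * I) := by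
  have h_int : ∀ σ : ℝ, σ₁ ≤ σ → σ ≤ σ₂ → Integrable fun y : ℝ => G (σ + y * I) := by
    intro σ h1 h2
    refine (integrable_one_add_abs_rpow.const_mul A).mono' ?_ (Eventually.of_forall fun y => ?_)
    · exact (hG.continuous.comp (by fun_prop)).aestronglyMeasurable
    · simpa using hb (σ + y * I) (by simpa using h1) (by simpa using h2)
  have lim : ∀ σ : ℝ, σ₁ ≤ σ → σ ≤ σ₂ → Tendsto (fun T : ℝ => ∫ y in (-T)..T, G (σ + y * I))
      atTop (nhds (∫ y : ℝ, G (σ + y * I))) := fun σ h1 h2 =>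
    intervalIntegral_tendsto_integral (h_int σ h1 h2) tendsto_neg_atTop_atBot tendsto_id
  have hor : ∀ e : ℝ, |e| = 1 →
      Tendsto (fun T : ℝ => ∫ x in σ₁..σ₂, G (x + (e * T : ℝ) * I)) atTop (nhds 0) := by
    intro e he
    have h0 := (tendsto_one_add_abs_rpow.const_mul A).mul_const |σ₂ - σ₁|
    rw [mul_zero, zero_mul] at h0
    refine squeeze_zero_norm (fun T => ?_) h0
    refine intervalIntegral.norm_integral_le_of_norm_le_const fun x hx => ?_
    rw [uIoc_of_le hσ] at hx
    simpa [abs_mul, he] using hb (x + (e * T : ℝ) * I) (by simpa using hx.1.le)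
      (by simpa using hx.2)
  have key : ∀ T : ℝ, (∫ y in (-T)..T, G (σ₁ + y * I)) = (∫ y in (-T)..T, G (σ₂ + y * I)) -
      I * ((∫ x in σ₁..σ₂, G (x + ((-1) * T : ℝ) * I)) -
        ∫ x in σ₁..σ₂, G (x + (1 * T : ℝ) * I)) := by
    intro T
    have := Complex.integral_boundary_rect_eq_zero_of_differentiableOn G (σ₁ + ((-T : ℝ) : ℂ) * I)
      (σ₂ + (T : ℂ) * I) hG.differentiableOn
    simp only [add_re, ofReal_re, mul_re, I_re, mul_zero, ofReal_im, I_im, mul_one,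
      add_zero, add_im, mul_im, zero_add, smul_eq_mul, sub_self] at this
    rw [neg_one_mul, one_mul]
    linear_combination (I : ℂ) * this - ((∫ y in (-T)..T, G (σ₂ + y * I)) -
      (∫ y in (-T)..T, G (σ₁ + y * I))) * (Complex.I_mul_I)
  refine tendsto_nhds_unique (lim σ₁ le_rfl hσ) ?_
  simp_rw [key]
  have := (lim σ₂ hσ le_rfl).sub (((hor (-1) (by simp)).sub (hor 1 (by simp))).const_mul I)
  simpa using this

namespace IsC2SupportedOn

variable {u₀ u₁ : ℝ} {f f' f'' : ℝ → ℂ}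

lemma exists_norm_mellin_le (h : IsC2SupportedOn u₀ u₁ f f' f'') (h₀ : 0 < u₀) (h₁ : u₀ < u₁) :
    ∃ A : ℝ, 0 ≤ A ∧ ∀ s : ℂ, 0 < s.re → s.re ≤ 2 → ‖mellin f s‖ ≤ A * (1 + |s.im|) ^ (-2 : ℝ) := by
  obtain ⟨K, hK1, hK⟩ := exists_mellin_bound h₀ h₁
  refine ⟨2 * (K * (1 ^ 2 * (∫ t in u₀..u₁, ‖f t‖) + ∫ t in u₀..u₁, ‖f'' t‖)), ?_,
    fun s hs hs2 => ?_⟩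
  · have i1 := intervalIntegral.integral_nonneg (μ := volume) h₁.le fun t _ => norm_nonneg (f t)
    have i2 := intervalIntegral.integral_nonneg (μ := volume) h₁.le fun t _ => norm_nonneg (f'' t)
    positivity
  · have := hK f f' f'' h s hs hs2 1
    have hp : 0 < 1 + |s.im| := by positivity
    rw [Real.rpow_neg hp.le, ← div_eq_mul_inv, le_div_iff₀ (by positivity), Real.rpow_two]
    have h3 : (1 + |s.im|) ^ 2 ≤ 2 * (1 ^ 2 + s.im ^ 2) := by
      rw [← sq_abs s.im]
      nlinarith [sq_nonneg (1 - |s.im|)]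
    calc ‖mellin f s‖ * (1 + |s.im|) ^ 2 ≤ ‖mellin f s‖ * (2 * (1 ^ 2 + s.im ^ 2)) := by gcongr
      _ = 2 * ((1 ^ 2 + s.im ^ 2) * ‖mellin f s‖) := by ring
      _ ≤ _ := by gcongr

lemma integrable_mellin (h : IsC2SupportedOn u₀ u₁ f f' f'') (h₀ : 0 < u₀) (h₁ : u₀ < u₁) {σ : ℝ}
    (hσ : 0 < σ) (hσ2 : σ ≤ 2) : Integrable fun y : ℝ => mellin f (σ + y * I) := by
  obtain ⟨A, hA0, hA⟩ := h.exists_norm_mellin_le h₀ h₁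
  have := integrable_one_add_norm (E := ℝ) (μ := volume) (r := 2) (by norm_num)
  refine (this.const_mul A).mono' ?_ (Eventually.of_forall fun y => ?_)
  · exact ((h.differentiable_mellin h₀).continuous.comp (by fun_prop)).aestronglyMeasurable
  · simpa using hA (σ + y * I) (by simpa using hσ) (by simpa using hσ2)

/-- Perron's formula with a smooth weight. -/
lemma tsum_eq_integral (h : IsC2SupportedOn u₀ u₁ f f' f'') (h₀ : 0 < u₀) (h₁ : u₀ < u₁)
    {α : ℕ → ℂ} {D : ℂ → ℂ} (hD : ∀ s : ℂ, s.re = 2 → LSeriesHasSum α s (D s)) {Y : ℝ}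
    (hY : 0 < Y) :
    ∑' n : ℕ, α n * f (n / Y) =
      (1 / (2 * Real.pi) : ℝ) * ∫ y : ℝ, (Y : ℂ) ^ ((2 : ℝ) + y * I) * D ((2 : ℝ) + y * I) *
        mellin f ((2 : ℝ) + y * I) := by
  have hY0 : (Y : ℂ) ≠ 0 := by exact_mod_cast hY.ne'
  have h_int := h.integrable_mellin h₀ h₁ two_pos le_rfl
  let F : ℕ → ℝ → ℂ := fun n y => LSeries.term α ((2 : ℝ) + y * I) n *
    ((Y : ℂ) ^ ((2 : ℝ) + y * I) * mellin f ((2 : ℝ) + y * I))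
  have hYnorm : ∀ y : ℝ, ‖(Y : ℂ) ^ ((2 : ℝ) + y * I)‖ = Y ^ (2 : ℝ) := fun y => by
    rw [Complex.norm_cpow_eq_rpow_re_of_pos hY]; simp
  have hcY : Continuous fun y : ℝ => (Y : ℂ) ^ ((2 : ℝ) + y * I) :=
    Continuous.const_cpow (by fun_prop) (Or.inl hY0)
  have hintY : Integrable fun y : ℝ => (Y : ℂ) ^ ((2 : ℝ) + y * I) * mellin f ((2 : ℝ) + y * I) := by
    refine h_int.bdd_mul (c := Y ^ (2 : ℝ)) hcY.aestronglyMeasurable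
      (Eventually.of_forall fun y => (hYnorm y).le)
  have htnorm : ∀ (n : ℕ) (y : ℝ), ‖LSeries.term α ((2 : ℝ) + y * I) n‖ =
      ‖LSeries.term α (2 : ℂ) n‖ := fun n y => by
    rw [LSeries.norm_term_eq, LSeries.norm_term_eq]; simp
  have htc : ∀ n : ℕ, Continuous fun y : ℝ => LSeries.term α ((2 : ℝ) + y * I) n := by
    intro n
    rcases eq_or_ne n 0 with rfl | hn
    · simpa using continuous_const
    · simp_rw [LSeries.term_of_ne_zero hn]
      have hn' : (n : ℂ) ≠ 0 := by exact_mod_cast hn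
      refine continuous_const.div (Continuous.const_cpow (by fun_prop) (Or.inl hn')) fun y => ?_
      exact (Complex.cpow_ne_zero_iff_of_exponent_ne_zero (fun h => by
        simpa using congrArg Complex.re h)).2 hn'
  have hFint : ∀ n, Integrable (F n) := fun n =>
    hintY.bdd_mul (c := ‖LSeries.term α (2 : ℂ) n‖) (htc n).aestronglyMeasurable
      (Eventually.of_forall fun y => (htnorm n y).le)
  have hFsum : Summable fun n => ∫ y, ‖F n y‖ := by
    have : ∀ n, ∫ y, ‖F n y‖ = ‖LSeries.term α (2 : ℂ) n‖ *
        ∫ y : ℝ, ‖(Y : ℂ) ^ ((2 : ℝ) + y * I) * mellin f ((2 : ℝ) + y * I)‖ := fun n => by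
      simp_rw [F, norm_mul (LSeries.term α _ n), htnorm]
      rw [integral_const_mul]
    simp_rw [this]
    exact ((hD 2 (by simp)).summable.norm).mul_right _
  have hsum := (hasSum_integral_of_summable_integral_norm hFint hFsum).mul_left
    (((1 / (2 * Real.pi) : ℝ)) : ℂ)
  have hterm : ∀ n : ℕ, α n * f (n / Y) = ((1 / (2 * Real.pi) : ℝ) : ℂ) * ∫ y, F n y := by
    intro n
    rcases eq_or_ne n 0 with rfl | hn
    · have : f 0 = 0 := h.eq_zero 0 fun h' => h'.1.not_gt h₀
      simp [F, this]
    · have hn0 : (0 : ℝ) < n := by exact_mod_cast Nat.pos_of_ne_zero hn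
      have inv := mellinInv_mellin_eq 2 f (x := n / Y) (by positivity)
        (h.mellinConvergent h₀ _) h_int h.continuous.continuousAt
      rw [← inv, mellinInv, Complex.real_smul, mul_left_comm, ← integral_const_mul]
      congr 1
      refine integral_congr_ae (Eventually.of_forall fun y => ?_)
      simp only [F, smul_eq_mul, LSeries.term_of_ne_zero hn]
      have e : (((n / Y : ℝ)) : ℂ) ^ (-((2 : ℝ) + y * I : ℂ)) =
          (n : ℂ) ^ (-((2 : ℝ) + y * I : ℂ)) * (Y : ℂ) ^ ((2 : ℝ) + y * I : ℂ) := by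
        rw [div_eq_mul_inv, Complex.ofReal_mul, Complex.mul_cpow_ofReal_nonneg hn0.le
          (by positivity), Complex.ofReal_inv, Complex.inv_cpow, Complex.cpow_neg (Y : ℂ), inv_inv]
        · simp
        · rw [Complex.arg_ofReal_of_nonneg hY.le]
          exact Real.pi_pos.ne
      rw [e, Complex.cpow_neg]
      ring
  simp_rw [hterm]
  rw [hsum.tsum_eq]
  congr 1
  refine integral_congr_ae (Eventually.of_forall fun y => ?_)
  simp only [F]
  rw [tsum_mul_right]
  have := (hD ((2 : ℝ) + y * I) (by simp)).LSeries_eq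
  rw [LSeries] at this
  rw [this]
  ring

end IsC2SupportedOn

end Perron

section WeightedSums

open Set Filter

lemma one_add_abs_rpow_mul_le {η v : ℝ} (hη : η ≤ 1 / 2) :
    (1 + |v|) ^ η ≤ 2 * (1 + v ^ 2) * (1 + |v|) ^ (-(3 / 2) : ℝ) := by
  have hp : 0 < 1 + |v| := by positivity
  have h1 : (1 + |v|) ^ 2 ≤ 2 * (1 + v ^ 2) := by
    rw [← sq_abs v]
    nlinarith [sq_nonneg (1 - |v|)]
  calc (1 + |v|) ^ η ≤ (1 + |v|) ^ (1 / 2 : ℝ) :=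
        Real.rpow_le_rpow_of_exponent_le (by linarith [abs_nonneg v]) hη
    _ = (1 + |v|) ^ 2 * (1 + |v|) ^ (-(3 / 2) : ℝ) := by
        rw [← Real.rpow_two, ← Real.rpow_add hp]
        norm_num
    _ ≤ _ := by gcongr

/-- Square-root type cancellation in smoothly weighted sums whose Dirichlet series is entire and
of small growth to the right of the line `Re s = σ`. -/
lemma exists_norm_tsum_mul_le {u₀ u₁ σ : ℝ} (h₀ : 0 < u₀) (h₁ : u₀ < u₁) (hσ : 0 < σ)
    (hσ2 : σ ≤ 2) :
    ∃ K : ℝ, 0 < K ∧ ∀ (f f' f'' : ℝ → ℂ), IsC2SupportedOn u₀ u₁ f f' f'' →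
      ∀ (α : ℕ → ℂ) (D : ℂ → ℂ), Differentiable ℂ D →
      (∀ s : ℂ, s.re = 2 → LSeriesHasSum α s (D s)) →
      ∀ B η : ℝ, 0 ≤ B → 0 ≤ η → η ≤ 1 / 2 →
      (∀ s : ℂ, σ ≤ s.re → s.re ≤ 2 → ‖D s‖ ≤ B * (|s.im| + 2) ^ η) →
      ∀ P Y R : ℝ, 0 < P → 0 < Y →
      P ^ 2 * (∫ t in u₀..u₁, ‖f t‖) + (∫ t in u₀..u₁, ‖f'' t‖) ≤ R →
      ‖∑' n : ℕ, α n * f (n / Y)‖ ≤ K * B * Y ^ σ * (P + 2) ^ η * (R / P) := by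
  obtain ⟨K, hK1, hK⟩ := exists_mellin_bound h₀ h₁
  set J := ∫ y : ℝ, (1 + |y|) ^ (-(3 / 2) : ℝ) with hJ
  have hJ0 : 0 ≤ J := integral_nonneg fun y => by positivity
  refine ⟨2 * K * (J + 1), by positivity, ?_⟩
  intro f f' f'' h α D hDd hD B η hB hη0 hη hDb P Y R hP hY hR
  have hR0 : 0 ≤ R := by
    refine le_trans ?_ hR
    have i1 := intervalIntegral.integral_nonneg (μ := volume) h₁.le fun t _ => norm_nonneg (f t)
    have i2 := intervalIntegral.integral_nonneg (μ := volume) h₁.le fun t _ => norm_nonneg (f'' t)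
    positivity
  have hY0 : (Y : ℂ) ≠ 0 := by exact_mod_cast hY.ne'
  let G : ℂ → ℂ := fun s => (Y : ℂ) ^ s * D s * mellin f s
  have hG : Differentiable ℂ G :=
    ((differentiable_id.const_cpow (Or.inl hY0)).mul hDd).mul (h.differentiable_mellin h₀)
  have hGn : ∀ s : ℂ, ‖G s‖ = Y ^ s.re * ‖D s‖ * ‖mellin f s‖ := fun s => by
    simp only [G, norm_mul, Complex.norm_cpow_eq_rpow_re_of_pos hY]
  obtain ⟨A, hA0, hA⟩ := h.exists_norm_mellin_le h₀ h₁
  have shift : ∫ y : ℝ, G (σ + y * I) = ∫ y : ℝ, G ((2 : ℝ) + y * I) := by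
    refine integral_vertical_eq (A := (max Y 1) ^ (2 : ℝ) * (B * 2) * A) hσ2 hG fun s hs1 hs2 => ?_
    have hp : 0 < 1 + |s.im| := by positivity
    rw [hGn]
    have e1 : Y ^ s.re ≤ (max Y 1) ^ (2 : ℝ) :=
      (Real.rpow_le_rpow hY.le (le_max_left _ _) (by linarith)).trans
        (Real.rpow_le_rpow_of_exponent_le (le_max_right _ _) hs2)
    have e2 : ‖D s‖ ≤ B * 2 * (1 + |s.im|) ^ (1 / 2 : ℝ) := by
      refine (hDb s hs1 hs2).trans ?_
      rw [mul_assoc]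
      gcongr
      calc (|s.im| + 2) ^ η ≤ (|s.im| + 2) ^ (1 / 2 : ℝ) :=
            Real.rpow_le_rpow_of_exponent_le (by linarith [abs_nonneg s.im]) hη
        _ ≤ (2 * (1 + |s.im|)) ^ (1 / 2 : ℝ) := by
            gcongr
            linarith [abs_nonneg s.im]
        _ = 2 ^ (1 / 2 : ℝ) * (1 + |s.im|) ^ (1 / 2 : ℝ) := Real.mul_rpow (by norm_num) hp.le
        _ ≤ 2 * (1 + |s.im|) ^ (1 / 2 : ℝ) := by
            gcongr
            exact (Real.rpow_le_rpow_of_exponent_le (by norm_num) (by norm_num)).trans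
              (Real.rpow_one 2).le
    have e3 := hA s (hσ.trans_le hs1) hs2
    calc Y ^ s.re * ‖D s‖ * ‖mellin f s‖
        ≤ (max Y 1) ^ (2 : ℝ) * (B * 2 * (1 + |s.im|) ^ (1 / 2 : ℝ)) *
            (A * (1 + |s.im|) ^ (-2 : ℝ)) := by gcongr
      _ = (max Y 1) ^ (2 : ℝ) * (B * 2) * A *
            ((1 + |s.im|) ^ (1 / 2 : ℝ) * (1 + |s.im|) ^ (-2 : ℝ)) := by ring
      _ = _ := by
          rw [← Real.rpow_add hp]
          norm_num
  rw [h.tsum_eq_integral h₀ h₁ hD hY]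
  change ‖_ * ∫ y : ℝ, G ((2 : ℝ) + y * I)‖ ≤ _
  rw [← shift, norm_mul]
  set L := 2 * K * B * Y ^ σ * (P + 2) ^ η * (R / P ^ 2) with hL
  have hL0 : 0 ≤ L := by positivity
  have hpt : ∀ y : ℝ, ‖G (σ + y * I)‖ ≤ L * (1 + |y / P|) ^ (-(3 / 2) : ℝ) := by
    intro y
    rw [hGn]
    have d1 := hDb (σ + y * I) (by simp) (by simpa using hσ2)
    have d2 := (hK f f' f'' h (σ + y * I) (by simpa using hσ) (by simpa using hσ2) P).trans
      (mul_le_mul_of_nonneg_left hR (by positivity))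
    simp only [add_re, ofReal_re, mul_re, I_re, mul_zero, ofReal_im, I_im, mul_one, sub_self,
      add_zero, add_im, mul_im, zero_add] at d1 d2 ⊢
    have hPy : 0 < P ^ 2 + y ^ 2 := by positivity
    have d3 : ‖mellin f (σ + y * I)‖ ≤ K * R / (P ^ 2 + y ^ 2) := by
      rw [le_div_iff₀ hPy, mul_comm]; exact d2
    have d4 : (|y| + 2) ^ η ≤ (P + 2) ^ η * (1 + |y / P|) ^ η := by
      rw [← Real.mul_rpow (by positivity) (by positivity)]
      gcongr
      have : |y| = P * |y / P| := by
        rw [abs_div, abs_of_pos hP]; field_simp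
      have h2 : 0 ≤ |y / P| := abs_nonneg _
      nlinarith
    have d5 := one_add_abs_rpow_mul_le (v := y / P) hη
    calc Y ^ σ * ‖D (σ + y * I)‖ * ‖mellin f (σ + y * I)‖
        ≤ Y ^ σ * (B * ((P + 2) ^ η * (2 * (1 + (y / P) ^ 2) * (1 + |y / P|) ^ (-(3 / 2) : ℝ)))) *
            (K * R / (P ^ 2 + y ^ 2)) := by
          gcongr
          refine d1.trans ?_
          gcongr
          refine d4.trans ?_
          gcongr
      _ = _ := by
          rw [hL]
          have : 1 + (y / P) ^ 2 = (P ^ 2 + y ^ 2) / P ^ 2 := by field_simp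
          rw [this]
          field_simp
  have hn : ‖((1 / (2 * Real.pi) : ℝ) : ℂ)‖ ≤ 1 := by
    rw [Complex.norm_real, Real.norm_eq_abs, abs_of_pos (by positivity),
      div_le_one (by positivity)]
    linarith [Real.pi_gt_three]
  have h_int : ‖∫ y : ℝ, G (σ + y * I)‖ ≤ L * (P * J) := by
    have hi := (integrable_one_add_abs_rpow.comp_div hP.ne').const_mul L
    refine (norm_integral_le_of_norm_le hi (Eventually.of_forall hpt)).trans ?_
    rw [integral_const_mul, Measure.integral_comp_div (fun v : ℝ => (1 + |v|) ^ (-(3 / 2) : ℝ)) P,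
      abs_of_pos hP, smul_eq_mul]
  calc _ ≤ 1 * (L * (P * J)) := by gcongr
    _ ≤ L * (P * (J + 1)) := by
        rw [one_mul]; gcongr; linarith
    _ = _ := by
        rw [hL]; field_simp

end WeightedSums

section SeparationWeights

open Set Filter

/-- A `C²` function which is integrable together with its first two derivatives. -/
structure IsC2Integrable (v v' v'' : ℝ → ℝ) : Prop where
  hasDerivAt : ∀ u, HasDerivAt v (v' u) u
  hasDerivAt' : ∀ u, HasDerivAt v' (v'' u) u
  continuous'' : Continuous v''
  integrable : Integrable v
  integrable' : Integrable v'
  integrable'' : Integrable v''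

lemma IsC2Integrable.continuous {v v' v'' : ℝ → ℝ} (h : IsC2Integrable v v' v'') : Continuous v :=
  continuous_iff_continuousAt.2 fun u => (h.hasDerivAt u).continuousAt

lemma IsC2Integrable.continuous' {v v' v'' : ℝ → ℝ} (h : IsC2Integrable v v' v'') : Continuous v' :=
  continuous_iff_continuousAt.2 fun u => (h.hasDerivAt' u).continuousAt

lemma ContDiff.infty_deriv {f : ℝ → ℝ} (hf : ContDiff ℝ (⊤ : ℕ∞) f) :
    ContDiff ℝ (⊤ : ℕ∞) (deriv f) := (contDiff_infty_iff_deriv.1 hf).2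

lemma ContDiff.infty_hasDerivAt {f : ℝ → ℝ} (hf : ContDiff ℝ (⊤ : ℕ∞) f) (u : ℝ) :
    HasDerivAt f (deriv f u) u := ((contDiff_infty_iff_deriv.1 hf).1 u).hasDerivAt

lemma isC2Integrable_of_contDiff {f : ℝ → ℝ} (hf : ContDiff ℝ (⊤ : ℕ∞) f)
    (hs : HasCompactSupport f) : IsC2Integrable f (deriv f) (deriv (deriv f)) where
  hasDerivAt := hf.infty_hasDerivAt
  hasDerivAt' := hf.infty_deriv.infty_hasDerivAt
  continuous'' := hf.infty_deriv.infty_deriv.continuous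
  integrable := hf.continuous.integrable_of_hasCompactSupport hs
  integrable' := hf.infty_deriv.continuous.integrable_of_hasCompactSupport hs.deriv
  integrable'' := hf.infty_deriv.infty_deriv.continuous.integrable_of_hasCompactSupport hs.deriv.deriv

lemma hasDerivAt_ite_pos {g g' : ℝ → ℝ} (hg : ∀ u, HasDerivAt g (g' u) u) (h0 : g 0 = 0)
    (h0' : g' 0 = 0) (z : ℝ) :
    HasDerivAt (fun u => if 0 < u then g u else 0) (if 0 < z then g' z else 0) z := by
  rcases lt_trichotomy z 0 with hz | rfl | hz
  · rw [if_neg hz.not_gt]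
    refine (hasDerivAt_const z (0 : ℝ)).congr_of_eventuallyEq ?_
    filter_upwards [Iio_mem_nhds hz] with u hu
    rw [if_neg (not_lt.2 (le_of_lt hu))]
  · rw [if_neg (lt_irrefl _), ← hasDerivWithinAt_univ, ← Iic_union_Ici (a := (0 : ℝ))]
    refine HasDerivWithinAt.union ?_ ?_
    · refine (hasDerivWithinAt_const (0 : ℝ) _ (0 : ℝ)).congr (fun u hu => ?_) (by simp)
      rw [if_neg (not_lt.2 hu)]
    · have := (hg 0).hasDerivWithinAt (s := Ici 0)
      rw [h0'] at this
      refine this.congr (fun u hu => ?_) (by simp [h0])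
      rcases eq_or_lt_of_le (show (0 : ℝ) ≤ u from hu) with rfl | hu
      · simp [h0]
      · rw [if_pos hu]
  · rw [if_pos hz]
    refine (hg z).congr_of_eventuallyEq ?_
    filter_upwards [Ioi_mem_nhds hz] with u hu
    exact if_pos hu

/-- The density `z ↦ z³ e^{-z} / 6` on `(0, ∞)`, the fundamental solution of `(1 + d/dz)⁴`. -/
noncomputable def gammaKernel (z : ℝ) : ℝ := if 0 < z then z ^ 3 / 6 * Real.exp (-z) else 0

lemma integrable_ite_pow_mul_exp (n : ℕ) :
    Integrable fun z : ℝ => if 0 < z then z ^ n * Real.exp (-z) else 0 := by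
  have h := Real.GammaIntegral_convergent (s := n + 1) (by positivity)
  have : (fun z : ℝ => if 0 < z then z ^ n * Real.exp (-z) else 0) =
      indicator (Ioi 0) (fun z => Real.exp (-z) * z ^ ((n : ℝ) + 1 - 1)) := by
    ext z
    rw [indicator_apply]
    simp only [mem_Ioi, add_sub_cancel_right, Real.rpow_natCast]
    split_ifs <;> ring
  rw [this, integrable_indicator_iff measurableSet_Ioi]
  exact h

lemma exists_isC2Integrable_gammaKernel : ∃ w' w'' : ℝ → ℝ, IsC2Integrable gammaKernel w' w'' := by
  have hE : ∀ u : ℝ, HasDerivAt (fun z : ℝ => Real.exp (-z)) (-Real.exp (-u)) u := fun u => by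
    simpa using (hasDerivAt_neg u).exp
  have d0 : ∀ u : ℝ, HasDerivAt (fun z : ℝ => z ^ 3 / 6 * Real.exp (-z))
      ((u ^ 2 / 2 - u ^ 3 / 6) * Real.exp (-u)) u := fun u => by
    refine (((hasDerivAt_pow 3 u).div_const 6).mul (hE u)).congr_deriv ?_
    push_cast; ring
  have d1 : ∀ u : ℝ, HasDerivAt (fun z : ℝ => (z ^ 2 / 2 - z ^ 3 / 6) * Real.exp (-z))
      ((u - u ^ 2 + u ^ 3 / 6) * Real.exp (-u)) u := fun u => by
    refine ((((hasDerivAt_pow 2 u).div_const 2).sub ((hasDerivAt_pow 3 u).div_const 6)).mul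
      (hE u)).congr_deriv ?_
    simp only [Pi.sub_apply]
    push_cast; ring
  refine ⟨fun z => if 0 < z then (z ^ 2 / 2 - z ^ 3 / 6) * Real.exp (-z) else 0,
    fun z => if 0 < z then (z - z ^ 2 + z ^ 3 / 6) * Real.exp (-z) else 0,
    hasDerivAt_ite_pos d0 (by simp) (by simp), hasDerivAt_ite_pos d1 (by simp) (by simp),
    ?_, ?_, ?_, ?_⟩
  · refine Continuous.if (fun a ha => ?_) (by fun_prop) continuous_const
    have : a = 0 := by
      have h := frontier_lt_subset_eq (f := fun _ : ℝ => (0 : ℝ)) (g := fun z : ℝ => z)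
        continuous_const continuous_id ha
      exact h.symm
    simp [this]
  · have := (integrable_ite_pow_mul_exp 3).div_const 6
    refine this.congr (Eventually.of_forall fun z => ?_)
    simp only [gammaKernel]
    split_ifs <;> ring
  · have := ((integrable_ite_pow_mul_exp 2).div_const 2).sub
      ((integrable_ite_pow_mul_exp 3).div_const 6)
    refine this.congr (Eventually.of_forall fun z => ?_)
    simp only [Pi.sub_apply]
    split_ifs <;> ring
  · have := ((integrable_ite_pow_mul_exp 1).sub (integrable_ite_pow_mul_exp 2)).add
      ((integrable_ite_pow_mul_exp 3).div_const 6)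
    refine this.congr (Eventually.of_forall fun z => ?_)
    simp only [Pi.sub_apply, Pi.add_apply]
    split_ifs <;> ring

/-- A smooth compactly supported function is a convolution of `gammaKernel` with another one. -/
lemma exists_eq_integral_gammaKernel {F : ℝ → ℝ} (hF : ContDiff ℝ (⊤ : ℕ∞) F)
    (hs : HasCompactSupport F) : ∃ G : ℝ → ℝ, ContDiff ℝ (⊤ : ℕ∞) G ∧ HasCompactSupport G ∧
      ∀ u, F u = ∫ x, gammaKernel (u - x) * G x := by
  have step : ∀ a : ℝ → ℝ, ContDiff ℝ (⊤ : ℕ∞) a → HasCompactSupport a → ∃ b : ℝ → ℝ,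
      ContDiff ℝ (⊤ : ℕ∞) b ∧ HasCompactSupport b ∧ ∀ x, HasDerivAt a (b x - a x) x :=
    fun a ha hsa => ⟨fun x => a x + deriv a x, ha.add ha.infty_deriv, hsa.add hsa.deriv,
      fun x => by simpa using ha.infty_hasDerivAt x⟩
  obtain ⟨a₁, c₁, s₁, d₁⟩ := step F hF hs
  obtain ⟨a₂, c₂, s₂, d₂⟩ := step a₁ c₁ s₁
  obtain ⟨a₃, c₃, s₃, d₃⟩ := step a₂ c₂ s₂
  obtain ⟨G, c₄, s₄, d₄⟩ := step a₃ c₃ s₃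
  refine ⟨G, c₄, s₄, fun u => ?_⟩
  have e1 : (fun x => gammaKernel (u - x) * G x) =
      indicator (Iio u) (fun x => (u - x) ^ 3 / 6 * Real.exp (-(u - x)) * G x) := by
    ext x
    rw [indicator_apply, gammaKernel]
    simp only [mem_Iio, sub_pos]
    split_ifs <;> ring
  rw [e1, integral_indicator measurableSet_Iio, ← integral_Iic_eq_integral_Iio]
  let U : ℝ → ℝ := fun x => Real.exp (-(u - x)) *
    ((u - x) ^ 3 / 6 * a₃ x + (u - x) ^ 2 / 2 * a₂ x + (u - x) * a₁ x + F x)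
  have hU : ∀ x, HasDerivAt U ((u - x) ^ 3 / 6 * Real.exp (-(u - x)) * G x) x := by
    intro x
    have hz : HasDerivAt (fun x : ℝ => u - x) (-1) x := by
      simpa using (hasDerivAt_id x).const_sub u
    have hE : HasDerivAt (fun x : ℝ => Real.exp (-(u - x))) (Real.exp (-(u - x))) x := by
      simpa using hz.neg.exp
    refine (hE.mul ((((((hz.pow 3).div_const 6).mul (d₄ x)).add
      (((hz.pow 2).div_const 2).mul (d₃ x))).add (hz.mul (d₂ x))).add (d₁ x))).congr_deriv ?_
    simp only [Pi.add_apply, Pi.mul_apply, Pi.pow_apply]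
    push_cast
    ring
  have hbot : Tendsto U atBot (nhds 0) := by
    refine tendsto_const_nhds.congr' ?_
    have ev : ∀ g : ℝ → ℝ, HasCompactSupport g → ∀ᶠ x in atBot, g x = 0 := fun g hg => by
      have h := hg.isCompact.isBounded.bddBelow
      obtain ⟨m, hm⟩ := h
      filter_upwards [eventually_lt_atBot m] with x hx
      exact image_eq_zero_of_notMem_tsupport fun h => (hm h).not_gt hx
    filter_upwards [ev _ hs, ev _ s₁, ev _ s₂, ev _ s₃] with x h0 h1 h2 h3
    simp [U, h0, h1, h2, h3]
  have h_int : Integrable fun x => (u - x) ^ 3 / 6 * Real.exp (-(u - x)) * G x :=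
    Continuous.integrable_of_hasCompactSupport (by have := c₄.continuous; fun_prop) s₄.mul_left
  rw [integral_Iic_of_hasDerivAt_of_tendsto' (fun x _ => hU x) h_int.integrableOn hbot]
  simp [U]

end SeparationWeights

section ProductWeights

open Set Filter

lemma integrable_comp_mul_sub {h : ℝ → ℝ} (hh : Integrable h) {P : ℝ} (hP : 0 < P) (x : ℝ) :
    Integrable fun u => |h (P * u - x)| :=
  ((hh.comp_sub_right x).comp_mul_left' hP.ne').abs

lemma intervalIntegral_comp_mul_sub_le {h : ℝ → ℝ} (hh : Integrable h) {P : ℝ} (hP : 0 < P)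
    (x : ℝ) {a b : ℝ} (hab : a ≤ b) : ∫ u in a..b, |h (P * u - x)| ≤ (∫ u, |h u|) / P := by
  rw [intervalIntegral.integral_of_le hab]
  refine (setIntegral_le_integral (integrable_comp_mul_sub hh hP x)
    (Eventually.of_forall fun u => abs_nonneg _)).trans (le_of_eq ?_)
  rw [Measure.integral_comp_mul_left (fun u => |h (u - x)|) P,
    integral_sub_right_eq_self (fun u => |h u|) x, abs_of_pos (by positivity), smul_eq_mul]
  field_simp

lemma exists_isC2SupportedOn_mul {Ψ : ℝ → ℝ} (hΨ : ContDiff ℝ (⊤ : ℕ∞) Ψ)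
    (hΨs : HasCompactSupport Ψ) {u₀ u₁ : ℝ} (h₁ : u₀ < u₁) (hsupp : tsupport Ψ ⊆ Ioo u₀ u₁)
    {v v' v'' : ℝ → ℝ} (hv : IsC2Integrable v v' v'') {p₀ : ℝ} (hp₀ : 0 < p₀) :
    ∃ K : ℝ, 0 < K ∧ ∀ P x : ℝ, p₀ ≤ P → ∃ f' f'' : ℝ → ℂ,
      IsC2SupportedOn u₀ u₁ (fun u => ((Ψ u * v (P * u - x) : ℝ) : ℂ)) f' f'' ∧
      P ^ 2 * (∫ t in u₀..u₁, ‖((Ψ t * v (P * t - x) : ℝ) : ℂ)‖) +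
        (∫ t in u₀..u₁, ‖f'' t‖) ≤ K * P := by
  obtain ⟨M₀, hM₀⟩ := hΨs.exists_bound_of_continuous hΨ.continuous
  obtain ⟨M₁, hM₁⟩ := hΨs.deriv.exists_bound_of_continuous hΨ.infty_deriv.continuous
  obtain ⟨M₂, hM₂⟩ := hΨs.deriv.deriv.exists_bound_of_continuous hΨ.infty_deriv.infty_deriv.continuous
  set M := max M₀ (max M₁ M₂)
  have hM0 : ∀ u, |Ψ u| ≤ M := fun u => (hM₀ u).trans (le_max_left _ _)
  have hM1 : ∀ u, |deriv Ψ u| ≤ M := fun u =>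
    (hM₁ u).trans ((le_max_left _ _).trans (le_max_right _ _))
  have hM2 : ∀ u, |deriv (deriv Ψ) u| ≤ M := fun u =>
    (hM₂ u).trans ((le_max_right _ _).trans (le_max_right _ _))
  have hMnn : 0 ≤ M := (abs_nonneg _).trans (hM0 0)
  set V := (∫ u, |v u|) + (∫ u, |v' u|) + ∫ u, |v'' u|
  have hV0 : 0 ≤ ∫ u, |v u| := integral_nonneg fun u => abs_nonneg _
  have hV1 : 0 ≤ ∫ u, |v' u| := integral_nonneg fun u => abs_nonneg _
  have hV2 : 0 ≤ ∫ u, |v'' u| := integral_nonneg fun u => abs_nonneg _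
  have hVnn : 0 ≤ V := by positivity
  refine ⟨2 * M * V * (1 + 1 / p₀ + 1 / p₀ ^ 2) + 1, by positivity, fun P x hP => ?_⟩
  have hP0 : 0 < P := hp₀.trans_le hP
  have z0 : ∀ u, u ∉ Ioo u₀ u₁ → Ψ u = 0 := fun u hu =>
    image_eq_zero_of_notMem_tsupport fun h => hu (hsupp h)
  have z1 : ∀ u, u ∉ Ioo u₀ u₁ → deriv Ψ u = 0 := fun u hu =>
    image_eq_zero_of_notMem_tsupport fun h => hu (hsupp (tsupport_deriv_subset h))
  have z2 : ∀ u, u ∉ Ioo u₀ u₁ → deriv (deriv Ψ) u = 0 := fun u hu =>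
    image_eq_zero_of_notMem_tsupport fun h =>
      hu (hsupp (tsupport_deriv_subset (tsupport_deriv_subset h)))
  have hlin : ∀ u, HasDerivAt (fun u : ℝ => P * u - x) P u := fun u => by
    simpa using ((hasDerivAt_id u).const_mul P).sub_const x
  have dv : ∀ u, HasDerivAt (fun u => v (P * u - x)) (P * v' (P * u - x)) u := fun u => by
    rw [mul_comm]
    exact (hv.hasDerivAt (P * u - x)).comp u (hlin u)
  have dv' : ∀ u, HasDerivAt (fun u => v' (P * u - x)) (P * v'' (P * u - x)) u := fun u => by
    rw [mul_comm]
    exact (hv.hasDerivAt' (P * u - x)).comp u (hlin u)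
  let g' : ℝ → ℝ := fun u => deriv Ψ u * v (P * u - x) + Ψ u * (P * v' (P * u - x))
  let g'' : ℝ → ℝ := fun u => deriv (deriv Ψ) u * v (P * u - x) +
    2 * P * (deriv Ψ u * v' (P * u - x)) + P ^ 2 * (Ψ u * v'' (P * u - x))
  have cv := hv.continuous
  have cv' := hv.continuous'
  have cv'' := hv.continuous''
  have cΨ := hΨ.continuous
  have cΨ' := hΨ.infty_deriv.continuous
  have cΨ'' := hΨ.infty_deriv.infty_deriv.continuous
  have cg'' : Continuous g'' := by simp only [g'']; fun_prop
  refine ⟨fun u => ((g' u : ℝ) : ℂ), fun u => ((g'' u : ℝ) : ℂ), ⟨fun u => ?_, fun u => ?_, ?_,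
    fun u hu => ?_, fun u hu => ?_, fun u hu => ?_⟩, ?_⟩
  · exact ((hΨ.infty_hasDerivAt u).mul (dv u)).ofReal_comp
  · refine HasDerivAt.ofReal_comp ((((hΨ.infty_deriv.infty_hasDerivAt u).mul (dv u)).add
      ((hΨ.infty_hasDerivAt u).mul ((dv' u).const_mul P))).congr_deriv ?_)
    simp only [g'']
    ring
  · exact continuous_ofReal.comp cg''
  · simp [z0 u hu]
  · simp [g', z0 u hu, z1 u hu]
  · simp [g'', z0 u hu, z1 u hu, z2 u hu]
  · have i0 := intervalIntegral_comp_mul_sub_le hv.integrable hP0 x h₁.le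
    have i1 := intervalIntegral_comp_mul_sub_le hv.integrable' hP0 x h₁.le
    have i2 := intervalIntegral_comp_mul_sub_le hv.integrable'' hP0 x h₁.le
    have j0 : ∫ t in u₀..u₁, ‖((Ψ t * v (P * t - x) : ℝ) : ℂ)‖ ≤ M * (V / P) := by
      calc ∫ t in u₀..u₁, ‖((Ψ t * v (P * t - x) : ℝ) : ℂ)‖
          ≤ ∫ t in u₀..u₁, M * |v (P * t - x)| := by
            refine intervalIntegral.integral_mono_on h₁.le ?_ ?_ fun t _ => ?_
            · exact Continuous.intervalIntegrable (by fun_prop) _ _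
            · exact Continuous.intervalIntegrable (by fun_prop) _ _
            · rw [Complex.norm_real, Real.norm_eq_abs, abs_mul]
              gcongr
              exact hM0 t
        _ ≤ M * (V / P) := by
            rw [intervalIntegral.integral_const_mul]
            gcongr
            refine i0.trans ?_
            gcongr
            simp only [V]
            linarith
    have j2 : ∫ t in u₀..u₁, ‖((g'' t : ℝ) : ℂ)‖ ≤ M * ((1 + 2 * P + P ^ 2) * (V / P)) := by
      calc ∫ t in u₀..u₁, ‖((g'' t : ℝ) : ℂ)‖
          ≤ ∫ t in u₀..u₁, M * (|v (P * t - x)| + 2 * P * |v' (P * t - x)| +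
              P ^ 2 * |v'' (P * t - x)|) := by
            refine intervalIntegral.integral_mono_on h₁.le ?_ ?_ fun t _ => ?_
            · exact Continuous.intervalIntegrable (by fun_prop) _ _
            · exact Continuous.intervalIntegrable (by fun_prop) _ _
            · rw [Complex.norm_real, Real.norm_eq_abs]
              simp only [g'']
              refine (abs_add_three _ _ _).trans ?_
              rw [abs_mul, abs_mul (2 * P), abs_mul (P ^ 2), abs_mul (deriv Ψ t), abs_mul (Ψ t),
                abs_of_pos (by positivity : 0 < 2 * P), abs_of_pos (by positivity : 0 < P ^ 2)]
              have := hM0 t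
              have := hM1 t
              have := hM2 t
              calc _ ≤ M * |v (P * t - x)| + 2 * P * (M * |v' (P * t - x)|) +
                    P ^ 2 * (M * |v'' (P * t - x)|) := by gcongr
                _ = _ := by ring
        _ = M * ((∫ t in u₀..u₁, |v (P * t - x)|) + 2 * P * (∫ t in u₀..u₁, |v' (P * t - x)|) +
              P ^ 2 * (∫ t in u₀..u₁, |v'' (P * t - x)|)) := by
            rw [intervalIntegral.integral_const_mul, intervalIntegral.integral_add,
              intervalIntegral.integral_add, intervalIntegral.integral_const_mul,
              intervalIntegral.integral_const_mul] <;>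
            exact Continuous.intervalIntegrable (by fun_prop) _ _
        _ ≤ M * (V / P + 2 * P * (V / P) + P ^ 2 * (V / P)) := by
            gcongr
            · refine i0.trans ?_
              gcongr
              simp only [V]
              linarith
            · refine i1.trans ?_
              gcongr
              simp only [V]
              linarith
            · refine i2.trans ?_
              gcongr
              simp only [V]
              linarith
        _ = _ := by ring
    have k1 : 1 ≤ 1 / p₀ * P := by
      rw [one_div, inv_mul_eq_div, le_div_iff₀ hp₀]; linarith
    have k2 : 1 / P ≤ 1 / p₀ ^ 2 * P := by
      rw [div_le_iff₀ hP0]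
      calc (1 : ℝ) ≤ (1 / p₀ * P) * (1 / p₀ * P) := by nlinarith
        _ = _ := by field_simp
    calc _ ≤ P ^ 2 * (M * (V / P)) + M * ((1 + 2 * P + P ^ 2) * (V / P)) := by gcongr
      _ = 2 * M * V * (P + 1 + (1 / P) / 2) := by field_simp; ring
      _ ≤ 2 * M * V * (P + 1 / p₀ * P + 1 / p₀ ^ 2 * P) := by
          have : 0 ≤ 1 / P := by positivity
          gcongr
          linarith
      _ ≤ _ := by nlinarith

end ProductWeights

section DoubleSums

open Set Filter

lemma exists_norm_sum_weight_le {Ψ : ℝ → ℝ} (hΨ : ContDiff ℝ (⊤ : ℕ∞) Ψ)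
    (hΨs : HasCompactSupport Ψ) {u₀ u₁ σ : ℝ} (h₀ : 0 < u₀) (h₁ : u₀ < u₁)
    (hsupp : tsupport Ψ ⊆ Ioo u₀ u₁) (hσ : 0 < σ) (hσ2 : σ ≤ 2)
    {v v' v'' : ℝ → ℝ} (hv : IsC2Integrable v v' v'') {p₀ : ℝ} (hp₀ : 0 < p₀) :
    ∃ K : ℝ, 0 < K ∧ ∀ (α : ℕ → ℂ) (D : ℂ → ℂ), Differentiable ℂ D →
      (∀ s : ℂ, s.re = 2 → LSeriesHasSum α s (D s)) →
      ∀ B η : ℝ, 0 ≤ B → 0 ≤ η → η ≤ 1 / 2 →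
      (∀ s : ℂ, σ ≤ s.re → s.re ≤ 2 → ‖D s‖ ≤ B * (|s.im| + 2) ^ η) →
      ∀ P Y x : ℝ, p₀ ≤ P → 0 < Y → ∀ S : Finset ℕ, (∀ n : ℕ, n ∉ S → Ψ (n / Y) = 0) →
      ‖∑ n ∈ S, α n * ((Ψ (n / Y) * v (P * (n / Y) - x) : ℝ) : ℂ)‖ ≤
        K * (B * Y ^ σ * (P + 2) ^ η) := by
  obtain ⟨K₁, hK₁, H₁⟩ := exists_norm_tsum_mul_le h₀ h₁ hσ hσ2
  obtain ⟨K₂, hK₂, H₂⟩ := exists_isC2SupportedOn_mul hΨ hΨs h₁ hsupp hv hp₀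
  refine ⟨K₁ * K₂, by positivity, ?_⟩
  intro α D hD hs B η hB hη0 hη hDb P Y x hP hY S hS
  obtain ⟨f', f'', hf, hR⟩ := H₂ P x hP
  have hP0 : 0 < P := hp₀.trans_le hP
  have := H₁ _ f' f'' hf α D hD hs B η hB hη0 hη hDb P Y _ hP0 hY hR
  rw [tsum_eq_sum (s := S) (fun n hn => by rw [hS n hn]; simp)] at this
  refine this.trans (le_of_eq ?_)
  field_simp

/-- Bound for a bilinear form near the diagonal, after separating variables. -/
lemma exists_norm_double_sum_le {Φ Ψ : ℝ → ℝ} (hΦ : ContDiff ℝ (⊤ : ℕ∞) Φ)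
    (hΦs : HasCompactSupport Φ) (hΦ' : tsupport Φ ⊆ Ioi 0) (hΨ : ContDiff ℝ (⊤ : ℕ∞) Ψ)
    (hΨs : HasCompactSupport Ψ) {u₀ u₁ σ : ℝ} (h₀ : 0 < u₀) (h₁ : u₀ < u₁)
    (hsupp : tsupport Ψ ⊆ Ioo u₀ u₁) (hσ : 0 < σ) (hσ2 : σ ≤ 2) {p₀ : ℝ} (hp₀ : 0 < p₀) :
    ∃ K : ℝ, 0 < K ∧ ∀ (α : ℕ → ℂ) (D : ℂ → ℂ), Differentiable ℂ D →
      (∀ s : ℂ, s.re = 2 → LSeriesHasSum α s (D s)) →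
      ∀ B η : ℝ, 0 ≤ B → 0 ≤ η → η ≤ 1 / 2 →
      (∀ s : ℂ, σ ≤ s.re → s.re ≤ 2 → ‖D s‖ ≤ B * (|s.im| + 2) ^ η) →
      ∀ P H : ℝ, p₀ ≤ P → 0 < H → ∀ S : Finset ℕ, (∀ n : ℕ, n ∉ S → Ψ (n / (P * H)) = 0) →
      ‖∑ M ∈ S, ∑ N ∈ S, α M * (starRingEnd ℂ) (α N) *
          ((Ψ (M / (P * H)) * Ψ (N / (P * H)) * Φ (|(M : ℝ) - N| / H) : ℝ) : ℂ)‖ ≤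
        K * (B * (P * H) ^ σ * (P + 2) ^ η) ^ 2 * P := by
  have hΦ0 : ∀ z, z ≤ 0 → Φ z = 0 := fun z hz =>
    image_eq_zero_of_notMem_tsupport fun h => not_lt.2 hz (hΦ' h)
  let F : ℝ → ℝ := fun u => Φ u + Φ (-u)
  have hFabs : ∀ u, F u = Φ |u| := fun u => by
    rcases le_total 0 u with hu | hu
    · simp [F, hΦ0 (-u) (by linarith), abs_of_nonneg hu]
    · simp [F, hΦ0 u hu, abs_of_nonpos hu]
  have hFc : ContDiff ℝ (⊤ : ℕ∞) F := hΦ.add (hΦ.comp contDiff_neg)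
  have hFs : HasCompactSupport F := hΦs.add (hΦs.comp_homeomorph (Homeomorph.neg ℝ))
  obtain ⟨G, hGc, hGs, hFG⟩ := exists_eq_integral_gammaKernel hFc hFs
  obtain ⟨w', w'', hw⟩ := exists_isC2Integrable_gammaKernel
  have hGr : IsC2Integrable (fun z => G (-z)) _ _ := isC2Integrable_of_contDiff
    (hGc.comp contDiff_neg) (hGs.comp_homeomorph (Homeomorph.neg ℝ))
  obtain ⟨K₁, hK₁, H₁⟩ := exists_norm_sum_weight_le hΨ hΨs h₀ h₁ hsupp hσ hσ2 hw hp₀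
  obtain ⟨K₂, hK₂, H₂⟩ := exists_norm_sum_weight_le hΨ hΨs h₀ h₁ hsupp hσ hσ2 hGr hp₀
  obtain ⟨A₀, hA₀⟩ := isBounded_iff_forall_norm_le.1 hGs.isCompact.isBounded
  set A := max A₀ 0
  have hA : ∀ z, A < |z| → G z = 0 := fun z hz => image_eq_zero_of_notMem_tsupport fun h =>
    ((hA₀ z h).trans (le_max_left _ _)).not_gt hz
  have hAnn : 0 ≤ A := le_max_right _ _
  refine ⟨K₁ * K₂ * (2 * A / p₀ + u₁), by have := h₀.trans h₁; positivity, ?_⟩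
  intro α D hD hs B η hB hη0 hη hDb P H hP hH S hS
  have hP0 : 0 < P := hp₀.trans_le hP
  set Y := P * H with hY
  have hY0 : 0 < Y := by positivity
  have hdiv : ∀ n : ℕ, P * ((n : ℝ) / Y) = n / H := fun n => by rw [hY]; field_simp
  let S₁ : ℝ → ℂ := fun x => ∑ n ∈ S, α n * ((Ψ (n / Y) * gammaKernel (P * (n / Y) - x) : ℝ) : ℂ)
  let S₂ : ℝ → ℂ := fun x => ∑ n ∈ S, α n * ((Ψ (n / Y) * G (-(P * (n / Y) - x)) : ℝ) : ℂ)
  have b1 : ∀ x, ‖S₁ x‖ ≤ K₁ * (B * Y ^ σ * (P + 2) ^ η) := fun x =>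
    H₁ α D hD hs B η hB hη0 hη hDb P Y x hP hY0 S hS
  have b2 : ∀ x, ‖S₂ x‖ ≤ K₂ * (B * Y ^ σ * (P + 2) ^ η) := fun x =>
    H₂ α D hD hs B η hB hη0 hη hDb P Y x hP hY0 S hS
  have z2 : ∀ x, x ∉ Icc (-A) (A + P * u₁) → S₂ x = 0 := by
    intro x hx
    refine Finset.sum_eq_zero fun n _ => ?_
    by_cases hn : (n : ℝ) / Y ∈ Ioo u₀ u₁
    · rw [hA, mul_zero, ofReal_zero, mul_zero]
      by_contra hcon
      rw [not_lt, abs_le] at hcon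
      have t1 : 0 < P * ((n : ℝ) / Y) := mul_pos hP0 (h₀.trans hn.1)
      have t2 : P * ((n : ℝ) / Y) < P * u₁ := mul_lt_mul_of_pos_left hn.2 hP0
      exact hx ⟨by linarith [hcon.1], by linarith [hcon.2]⟩
    · rw [image_eq_zero_of_notMem_tsupport (fun h => hn (hsupp h))]
      simp
  have cw := hw.continuous
  have cG := hGc.continuous
  have hconv : ∀ M N : ℕ, Φ (|(M : ℝ) - N| / H) =
      ∫ x, gammaKernel (P * (M / Y) - x) * G (-(P * (N / Y) - x)) := by
    intro M N
    rw [hdiv, hdiv, ← abs_of_pos hH, ← abs_div, ← hFabs, abs_of_pos hH, hFG,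
      ← integral_sub_right_eq_self _ ((N : ℝ) / H)]
    refine integral_congr_ae (Eventually.of_forall fun x => ?_)
    simp only
    congr 2 <;> ring
  have h_int : ∀ M N : ℕ, Integrable fun x =>
      gammaKernel (P * (M / Y) - x) * G (-(P * (N / Y) - x)) := by
    intro M N
    refine Continuous.integrable_of_hasCompactSupport (by fun_prop) (HasCompactSupport.mul_left ?_)
    have : (fun x => G (-(P * (N / Y) - x))) = G ∘ (Homeomorph.subRight (P * ((N : ℝ) / Y))) := by
      ext x
      simp
    rw [this]
    exact hGs.comp_homeomorph _
  have hT : ∑ M ∈ S, ∑ N ∈ S, α M * (starRingEnd ℂ) (α N) *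
          ((Ψ (M / Y) * Ψ (N / Y) * Φ (|(M : ℝ) - N| / H) : ℝ) : ℂ) =
      ∫ x, S₁ x * (starRingEnd ℂ) (S₂ x) := by
    have e : ∀ x, S₁ x * (starRingEnd ℂ) (S₂ x) = ∑ M ∈ S, ∑ N ∈ S, α M * (starRingEnd ℂ) (α N) *
        ((Ψ (M / Y) * Ψ (N / Y) : ℝ) : ℂ) *
        ((gammaKernel (P * (M / Y) - x) * G (-(P * (N / Y) - x)) : ℝ) : ℂ) := fun x => by
      simp only [S₁, S₂, map_sum, Finset.sum_mul_sum, map_mul, conj_ofReal]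
      refine Finset.sum_congr rfl fun M _ => Finset.sum_congr rfl fun N _ => ?_
      push_cast
      ring
    simp_rw [e]
    rw [integral_finsetSum _ fun M _ => integrable_finsetSum _ fun N _ =>
      ((h_int M N).ofReal.const_mul _)]
    refine Finset.sum_congr rfl fun M _ => ?_
    rw [integral_finsetSum _ fun N _ => ((h_int M N).ofReal.const_mul _)]
    refine Finset.sum_congr rfl fun N _ => ?_
    rw [integral_const_mul, integral_complex_ofReal, hconv M N]
    push_cast
    ring
  rw [hT, ← setIntegral_eq_integral_of_forall_compl_eq_zero (s := Icc (-A) (A + P * u₁))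
    (fun x hx => by rw [z2 x hx]; simp)]
  set b := B * Y ^ σ * (P + 2) ^ η
  have hb : 0 ≤ b := by positivity
  refine (norm_setIntegral_le_of_norm_le_const (C := K₁ * b * (K₂ * b)) measure_Icc_lt_top
    fun x _ => ?_).trans ?_
  · rw [norm_mul, RCLike.norm_conj]
    exact mul_le_mul (b1 x) (b2 x) (norm_nonneg _) (by positivity)
  · have hu1 : 0 < u₁ := h₀.trans h₁
    rw [Real.volume_real_Icc_of_le (by nlinarith [mul_pos hP0 hu1])]
    have : 2 * A ≤ 2 * A / p₀ * P := by
      rw [div_mul_eq_mul_div, le_div_iff₀ hp₀]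
      gcongr
    calc K₁ * b * (K₂ * b) * (A + P * u₁ - -A) = K₁ * K₂ * b ^ 2 * (2 * A + u₁ * P) := by ring
      _ ≤ K₁ * K₂ * b ^ 2 * (2 * A / p₀ * P + u₁ * P) := by gcongr
      _ = _ := by ring

end DoubleSums

section CongruentSums

open Set

set_option maxHeartbeats 800000 in
lemma GRH.exists_norm_dk_double_sum_le (hGRH : GRH) {k : ℕ} (hk : k ≠ 0) {Φ Ψ : ℝ → ℝ}
    (hΦ : ContDiff ℝ (⊤ : ℕ∞) Φ) (hΦs : HasCompactSupport Φ) {b₀ : ℝ} (hb₀ : 0 < b₀)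
    (hΦ' : tsupport Φ ⊆ Ioi b₀) (hΨ : ContDiff ℝ (⊤ : ℕ∞) Ψ)
    (hΨs : HasCompactSupport Ψ) {u₀ u₁ : ℝ} (h₀ : 0 < u₀) (h₁ : u₀ < u₁)
    (hsupp : tsupport Ψ ⊆ Ioo u₀ u₁) {ε : ℝ} (hε : 0 < ε) (hε1 : ε ≤ 1) :
    ∃ C : ℝ, 0 < C ∧ ∀ X Q : ℝ, 1 ≤ X → 1 ≤ Q → ∀ g b a r : ℕ, 0 < g → 0 < b → 0 < r → a ∣ g →
      ∀ χ : DirichletCharacter ℂ (a * r), χ ≠ 1 → ∀ S : Finset ℕ,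
      (∀ n : ℕ, n ∉ S → Ψ ((g * b * n : ℕ) / X) = 0) →
      ‖∑ M ∈ S, ∑ N ∈ S, (dk k (g * b * M) * χ M) * (starRingEnd ℂ) (dk k (g * b * N) * χ N) *
        ((Ψ ((g * b * M : ℕ) / X) * Ψ ((g * b * N : ℕ) / X) *
          Φ (|(b * M : ℝ) - b * N| / (r * Q)) : ℝ) : ℂ)‖ ≤
        C * X ^ (2 + ε) / (g ^ 2 * b * r * Q) := by
  have hu1 : 0 < u₁ := h₀.trans h₁
  have hk0 : (0 : ℝ) < k := by exact_mod_cast Nat.pos_of_ne_zero hk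
  have hk1 : (1 : ℝ) ≤ k := by exact_mod_cast Nat.pos_of_ne_zero hk
  set e : ℝ := ε / (16 * k) with he
  have he0 : 0 < e := by positivity
  have hek : e * k = ε / 16 := by rw [he]; field_simp
  set p₀ := b₀ / u₁ with hp₀
  have hp0 : 0 < p₀ := by positivity
  set σ : ℝ := 1 / 2 + 2 * (ε / 8) with hσ
  obtain ⟨C₁, hC₁, H₁⟩ := hGRH.norm_LFunction_le_rpow (δ := ε / 8) (by linarith) (by linarith) he0
  obtain ⟨C₂, hC₂, H₂⟩ := exists_card_divisors_le_rpow he0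
  obtain ⟨K, hK, H₃⟩ := exists_norm_double_sum_le hΦ hΦs
    (hΦ'.trans (Ioi_subset_Ioi hb₀.le)) hΨ hΨs h₀ h₁ hsupp (σ := σ) (by linarith) (by linarith) hp0
  set A : ℝ := max (max u₁ (1 / p₀)) 3 with hA
  have hAu : u₁ ≤ A := (le_max_left _ _).trans (le_max_left _ _)
  have hAp : 1 / p₀ ≤ A := (le_max_right _ _).trans (le_max_left _ _)
  have hA3 : 3 ≤ A := le_max_right _ _
  have hA0 : 0 < A := by linarith
  refine ⟨K * ((C₁ * C₂) ^ k * A ^ (ε / 4)) ^ 2, by positivity, ?_⟩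
  intro X Q hX hQ g b a r hg hb hr hag χ hχ S hS
  have hX0 : 0 < X := by linarith
  have hQ0 : 0 < Q := by linarith
  have hgR : (1 : ℝ) ≤ g := by exact_mod_cast hg
  have hbR : (1 : ℝ) ≤ b := by exact_mod_cast hb
  have hrR : (1 : ℝ) ≤ r := by exact_mod_cast hr
  have hg0 : (0 : ℝ) < g := by linarith
  have hb0 : (0 : ℝ) < b := by linarith
  have hr0 : (0 : ℝ) < r := by linarith
  have hΨ0 : ∀ z, z ∉ Ioo u₀ u₁ → Ψ z = 0 := fun z hz =>
    image_eq_zero_of_notMem_tsupport fun h => hz (hsupp h)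
  have hΦ0 : ∀ z, z ≤ b₀ → Φ z = 0 := fun z hz =>
    image_eq_zero_of_notMem_tsupport fun h => (hΦ' h).not_ge hz
  have hRHS : 0 ≤ K * ((C₁ * C₂) ^ k * A ^ (ε / 4)) ^ 2 * X ^ (2 + ε) / (g ^ 2 * b * r * Q) := by
    positivity
  set P : ℝ := X / (g * r * Q) with hP
  set H : ℝ := r * Q / b with hH
  have hP0 : 0 < P := by positivity
  have hH0 : 0 < H := by positivity
  have hPH : P * H = X / (g * b) := by rw [hP, hH]; field_simp
  have hscale : ∀ n : ℕ, ((g * b * n : ℕ) : ℝ) / X = n / (P * H) := fun n => by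
    rw [hPH]; push_cast; field_simp
  have hscale' : ∀ M N : ℕ, |(b * M : ℝ) - b * N| / (r * Q) = |(M : ℝ) - N| / H := fun M N => by
    rw [← mul_sub, abs_mul, abs_of_pos hb0, hH]; field_simp
  simp only [hscale, hscale'] at hS ⊢
  by_cases hc : ((g * b : ℕ) : ℝ) ≤ u₁ * X
  swap
  · rw [Finset.sum_eq_zero, norm_zero]
    · exact hRHS
    intro M _
    refine Finset.sum_eq_zero fun N _ => ?_
    rw [hΨ0 ((M : ℝ) / (P * H))]
    · simp
    rintro ⟨h1, h2⟩
    rcases Nat.eq_zero_or_pos M with rfl | hM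
    · simp at h1
      linarith
    · rw [← hscale, div_lt_iff₀ hX0] at h2
      refine hc (le_trans ?_ h2.le)
      exact_mod_cast Nat.le_mul_of_pos_right _ hM
  by_cases hPp : p₀ ≤ P
  swap
  · rw [Finset.sum_eq_zero, norm_zero]
    · exact hRHS
    intro M _
    refine Finset.sum_eq_zero fun N _ => ?_
    by_cases h1 : (M : ℝ) / (P * H) ∈ Ioo u₀ u₁
    swap
    · rw [hΨ0 _ h1]; simp
    by_cases h2 : (N : ℝ) / (P * H) ∈ Ioo u₀ u₁
    swap
    · rw [hΨ0 _ h2]; simp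
    rw [hΦ0 (|(M : ℝ) - N| / H)]
    · simp
    have h3 := h1.2
    have h4 := h2.2
    rw [div_lt_iff₀ (by positivity)] at h3 h4
    have h5 : |(M : ℝ) - N| ≤ u₁ * (P * H) := by
      rw [abs_le]
      have h6 := Nat.cast_nonneg (α := ℝ) M
      have h7 := Nat.cast_nonneg (α := ℝ) N
      constructor <;> linarith
    rw [div_le_iff₀ hH0]
    refine h5.trans ?_
    rw [← mul_assoc]
    gcongr
    rw [not_le, hp₀, lt_div_iff₀ hu1] at hPp
    linarith
  have ha : 0 < a := Nat.pos_of_dvd_of_pos hag hg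
  have : NeZero (a * r) := ⟨(Nat.mul_pos ha hr).ne'⟩
  have hcne : g * b ≠ 0 := (Nat.mul_pos hg hb).ne'
  obtain ⟨D, hD, hDs, hDb⟩ := exists_entire_extension_dk_mul hC₁ he0 H₁ hχ k (g * b) hcne
  have hc0 : (0 : ℝ) < (g * b : ℕ) := by exact_mod_cast Nat.mul_pos hg hb
  have hq0 : (0 : ℝ) < (a * r : ℕ) := by exact_mod_cast Nat.mul_pos ha hr
  set B : ℝ := ((g * b).divisors.card * (C₁ * (((a * r : ℕ) : ℝ) * (g * b : ℕ)) ^ e)) ^ k with hB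
  have hB0 : 0 ≤ B := by positivity
  have key := H₃ _ D hD (fun s hs => hDs s (by rw [hs]; norm_num)) B (e * k) hB0 (by positivity)
    (by linarith) (fun s hs hs2 => by
      refine (hDb s hs hs2).trans (le_of_eq ?_)
      have ht : (0 : ℝ) ≤ |s.im| + 2 := by positivity
      rw [Real.mul_rpow (by positivity) ht, Real.rpow_mul_natCast ht, hB, ← mul_pow]
      ring) P H hPp hH0 S hS
  refine key.trans ?_
  clear_value e σ p₀ A P H B
  clear key H₁ H₃ hDb hDs hD D hS S hΨ0 hΦ0 hscale hscale'
  have hZ0 : 0 < A * X := by positivity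
  have hcZ : ((g * b : ℕ) : ℝ) ≤ A * X := hc.trans (by gcongr)
  have hqZ : ((a * r : ℕ) : ℝ) ≤ A * X := by
    have h6 : (a : ℝ) ≤ g := by exact_mod_cast Nat.le_of_dvd hg hag
    have h7 : g * r * Q ≤ 1 / p₀ * X := by
      rw [hP, le_div_iff₀ (by positivity)] at hPp
      rw [one_div, inv_mul_eq_div, le_div_iff₀ hp0]
      linarith
    push_cast
    calc (a : ℝ) * r ≤ g * r := by gcongr
      _ ≤ g * r * Q := le_mul_of_one_le_right (by positivity) hQ
      _ ≤ 1 / p₀ * X := h7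
      _ ≤ A * X := by gcongr
  have hPZ : P + 2 ≤ A * X := by
    have : P ≤ X := by
      rw [hP]
      refine div_le_self hX0.le ?_
      exact one_le_mul_of_one_le_of_one_le (one_le_mul_of_one_le_of_one_le hgR hrR) hQ
    have : 3 * X ≤ A * X := by gcongr
    linarith
  have hBP : B * (P + 2) ^ (e * k) ≤ (C₁ * C₂) ^ k * (A * X) ^ (ε / 4) := by
    have h8 : (A * X) ^ (ε / 4) = ((A * X) ^ e * (A * X) ^ e * (A * X) ^ e) ^ k *
        (A * X) ^ (e * k) := by
      rw [Real.rpow_mul_natCast hZ0.le, ← mul_pow, ← Real.rpow_add hZ0, ← Real.rpow_add hZ0,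
        ← Real.rpow_add hZ0, ← Real.rpow_mul_natCast hZ0.le]
      congr 1
      linarith
    rw [h8, ← mul_assoc, ← mul_pow, hB]
    refine mul_le_mul (pow_le_pow_left₀ (by positivity) ?_ k)
      (Real.rpow_le_rpow (by positivity) hPZ (by positivity)) (by positivity) (by positivity)
    have h9 := H₂ (g * b) hcne
    rw [Real.mul_rpow hq0.le hc0.le]
    calc ((g * b).divisors.card : ℝ) * (C₁ * (((a * r : ℕ) : ℝ) ^ e * ((g * b : ℕ) : ℝ) ^ e))
        ≤ (C₂ * (A * X) ^ e) * (C₁ * ((A * X) ^ e * (A * X) ^ e)) := by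
          gcongr
          exact h9.trans (by gcongr)
      _ = _ := by ring
  have hY : (X / (g * b)) ^ σ * (X / (g * b)) ^ σ ≤ X / (g * b) * X ^ (ε / 2) := by
    have hY0 : 0 < X / (g * b) := by positivity
    rw [← Real.rpow_add hY0, show σ + σ = 1 + ε / 2 by rw [hσ]; ring, Real.rpow_add hY0,
      Real.rpow_one]
    gcongr
    exact div_le_self hX0.le (one_le_mul_of_one_le_of_one_le hgR hbR)
  rw [hPH]
  calc K * (B * (X / (g * b)) ^ σ * (P + 2) ^ (e * k)) ^ 2 * P
      = K * (B * (P + 2) ^ (e * k)) ^ 2 * ((X / (g * b)) ^ σ * (X / (g * b)) ^ σ) * P := by ring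
    _ ≤ K * ((C₁ * C₂) ^ k * (A * X) ^ (ε / 4)) ^ 2 * (X / (g * b) * X ^ (ε / 2)) * P := by
        gcongr
    _ = _ := by
        have h10 : X ^ (2 + ε) = X ^ 2 * (X ^ (ε / 4) * X ^ (ε / 4) * X ^ (ε / 2)) := by
          rw [← Real.rpow_add hX0, ← Real.rpow_add hX0, ← Real.rpow_natCast X 2,
            ← Real.rpow_add hX0]
          congr 1
          push_cast
          ring
        rw [h10, Real.mul_rpow hA0.le hX0.le, hP]
        field_simp

end CongruentSums

section GcdSums

open Finset

lemma sum_ite_mul_dvd_moebius {g m n K : ℕ} (hg : 0 < g) (hm : m ∈ Icc 1 K) (hn : 0 < n) :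
    (∑ b ∈ Icc 1 K, if g * b ∣ m ∧ g * b ∣ n then ArithmeticFunction.moebius b else 0) =
      if m.gcd n = g then 1 else 0 := by
  rw [mem_Icc] at hm
  by_cases h : g ∣ m.gcd n
  · obtain ⟨G, hG⟩ := h
    have hpos : 0 < m.gcd n := Nat.gcd_pos_of_pos_right _ hn
    have hG0 : G ≠ 0 := by
      rintro rfl
      simp [hG] at hpos
    have hGK : G ≤ K := by
      have h1 : m.gcd n ≤ m := Nat.gcd_le_left _ hm.1
      have h2 : G ≤ g * G := Nat.le_mul_of_pos_left _ hg
      omega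
    have e1 : ∀ b, (g * b ∣ m ∧ g * b ∣ n) ↔ b ∣ G := fun b => by
      rw [← Nat.dvd_gcd_iff, hG, Nat.mul_dvd_mul_iff_left hg]
    have e2 : (Icc 1 K).filter (· ∣ G) = G.divisors := by
      ext b
      simp only [mem_filter, mem_Icc, Nat.mem_divisors]
      constructor
      · exact fun h => ⟨h.2, hG0⟩
      · exact fun h => ⟨⟨Nat.pos_of_dvd_of_pos h.1 (Nat.pos_of_ne_zero hG0),
          (Nat.le_of_dvd (Nat.pos_of_ne_zero hG0) h.1).trans hGK⟩, h.1⟩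
    have e3 : m.gcd n = g ↔ G = 1 := by
      rw [hG]
      constructor
      · exact fun h => Nat.eq_of_mul_eq_mul_left hg (by rw [h, mul_one])
      · rintro rfl
        exact mul_one g
    simp_rw [e1]
    rw [← sum_filter, e2, ← ArithmeticFunction.coe_mul_zeta_apply,
      ArithmeticFunction.moebius_mul_coe_zeta, ArithmeticFunction.one_apply]
    simp only [e3]
  · rw [if_neg (fun h' => h (dvd_of_eq h'.symm))]
    refine sum_eq_zero fun b _ => if_neg fun hb => h ?_
    exact (Dvd.intro _ rfl).trans (Nat.dvd_gcd hb.1 hb.2)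

lemma sum_Icc_ite_dvd {R : Type*} [AddCommMonoid R] {c K : ℕ} (hc : 0 < c) {h : ℕ → R}
    (hh : ∀ m, m ∉ Icc 1 K → h m = 0) :
    (∑ m ∈ Icc 1 K, if c ∣ m then h m else 0) = ∑ M ∈ Icc 1 K, h (c * M) := by
  rw [← sum_filter, ← sum_filter_of_ne (s := Icc 1 K) (p := fun M => c * M ∈ Icc 1 K)
    (f := fun M => h (c * M)) (fun M _ hM => by
      by_contra hcon
      exact hM (hh _ hcon))]
  refine (sum_nbij' (fun M => c * M) (fun m => m / c) ?_ ?_ ?_ ?_ ?_).symm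
  · intro M hM
    simp only [mem_filter] at hM ⊢
    exact ⟨hM.2, Dvd.intro _ rfl⟩
  · intro m hm
    simp only [mem_filter, mem_Icc] at hm ⊢
    obtain ⟨⟨h1, h2⟩, M, rfl⟩ := hm
    rw [Nat.mul_div_cancel_left _ hc]
    have h3 : M ≤ c * M := Nat.le_mul_of_pos_left _ hc
    have h4 : 0 < M := Nat.pos_of_mul_pos_left h1
    exact ⟨⟨h4, h3.trans h2⟩, h1, h2⟩
  · intro M _
    exact Nat.mul_div_cancel_left _ hc
  · intro m hm
    exact Nat.mul_div_cancel' (mem_filter.1 hm).2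
  · intro M _
    rfl

/-- Möbius inversion over the common divisors of the summation variables. -/
lemma sum_sum_ite_gcd_eq {g K : ℕ} (hg : 0 < g) {f : ℕ → ℕ → ℂ}
    (hf : ∀ m n, m ∉ Icc 1 K ∨ n ∉ Icc 1 K → f m n = 0) :
    (∑ m ∈ Icc 1 K, ∑ n ∈ Icc 1 K, if m.gcd n = g then f m n else 0) =
      ∑ b ∈ Icc 1 K, (ArithmeticFunction.moebius b : ℂ) *
        ∑ M ∈ Icc 1 K, ∑ N ∈ Icc 1 K, f (g * b * M) (g * b * N) := by
  have e1 : ∀ b ∈ Icc 1 K, ∑ M ∈ Icc 1 K, ∑ N ∈ Icc 1 K, f (g * b * M) (g * b * N) =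
      ∑ m ∈ Icc 1 K, ∑ n ∈ Icc 1 K, if g * b ∣ m ∧ g * b ∣ n then f m n else 0 := by
    intro b hb
    have hc : 0 < g * b := Nat.mul_pos hg (mem_Icc.1 hb).1
    rw [← sum_Icc_ite_dvd hc (h := fun m => ∑ N ∈ Icc 1 K, f m (g * b * N))
      (fun m hm => sum_eq_zero fun N _ => hf _ _ (Or.inl hm))]
    refine sum_congr rfl fun m _ => ?_
    split_ifs with h
    · rw [← sum_Icc_ite_dvd hc (h := fun n => f m n) (fun n hn => hf _ _ (Or.inr hn))]
      simp [h]
    · simp [h]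
  refine Eq.trans ?_ (sum_congr rfl fun b hb => by rw [e1 b hb]).symm
  simp_rw [mul_sum]
  refine Eq.trans ?_ sum_comm
  refine sum_congr rfl fun m hm => ?_
  refine Eq.trans ?_ sum_comm
  refine sum_congr rfl fun n hn => ?_
  have := sum_ite_mul_dvd_moebius hg hm (mem_Icc.1 hn).1
  calc (if m.gcd n = g then f m n else 0) =
      (((if m.gcd n = g then 1 else 0 : ℤ)) : ℂ) * f m n := by split_ifs <;> simp
    _ = _ := by
      rw [← this, Int.cast_sum, sum_mul]
      refine sum_congr rfl fun b _ => ?_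
      split_ifs <;> simp

lemma exists_sum_one_div_le {A ε : ℝ} (hA : 0 < A) (hε : 0 < ε) :
    ∃ C : ℝ, 0 ≤ C ∧ ∀ X : ℝ, 0 < X → ∀ n : ℕ, n ≤ A * X →
      ∑ i ∈ Icc 1 n, (1 : ℝ) / i ≤ C * X ^ ε := by
  have hs : Summable fun i : ℕ => (1 : ℝ) / (i : ℝ) ^ (1 + ε) :=
    Real.summable_one_div_nat_rpow.2 (by linarith)
  have hnn : ∀ i : ℕ, 0 ≤ (1 : ℝ) / (i : ℝ) ^ (1 + ε) := fun i => by positivity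
  refine ⟨A ^ ε * ∑' i : ℕ, (1 : ℝ) / (i : ℝ) ^ (1 + ε),
    mul_nonneg (by positivity) (tsum_nonneg hnn), ?_⟩
  intro X hX n hn
  calc ∑ i ∈ Icc 1 n, (1 : ℝ) / i ≤ ∑ i ∈ Icc 1 n, (A * X) ^ ε * (1 / (i : ℝ) ^ (1 + ε)) := by
        refine sum_le_sum fun i hi => ?_
        have hi0 : (0 : ℝ) < i := by exact_mod_cast (mem_Icc.1 hi).1
        have hin : (i : ℝ) ≤ A * X := le_trans (by exact_mod_cast (mem_Icc.1 hi).2) hn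
        rw [Real.rpow_add hi0, Real.rpow_one, mul_one_div, div_le_div_iff₀ hi0 (by positivity)]
        rw [one_mul, mul_comm]
        gcongr
    _ = (A * X) ^ ε * ∑ i ∈ Icc 1 n, 1 / (i : ℝ) ^ (1 + ε) := by rw [mul_sum]
    _ ≤ (A * X) ^ ε * ∑' i : ℕ, 1 / (i : ℝ) ^ (1 + ε) := by
        gcongr
        exact hs.sum_le_tsum _ fun i _ => hnn i
    _ = _ := by rw [Real.mul_rpow hA.le hX.le]; ring

lemma tsum_tsum_tsum_tsum_eq_sum {I R : Finset ℕ} {F : ℕ → ℕ → ℕ → ℕ → ℂ}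
    (hF : ∀ m n a r, F m n a r ≠ 0 → m ∈ I ∧ n ∈ I ∧ a ∈ I ∧ r ∈ R) :
    ∑' m, ∑' n, ∑' a, ∑' r, F m n a r =
      ∑ m ∈ I, ∑ n ∈ I, ∑ a ∈ I, ∑ r ∈ R, F m n a r := by
  have h0 : ∀ m n a r, ¬(m ∈ I ∧ n ∈ I ∧ a ∈ I ∧ r ∈ R) → F m n a r = 0 := fun m n a r h =>
    not_not.1 (mt (hF m n a r) h)
  rw [tsum_eq_sum (s := I) fun m hm => by simp [h0, hm]]
  refine sum_congr rfl fun m _ => ?_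
  rw [tsum_eq_sum (s := I) fun n hn => by simp [h0, hn]]
  refine sum_congr rfl fun n _ => ?_
  rw [tsum_eq_sum (s := I) fun a ha => by simp [h0, ha]]
  refine sum_congr rfl fun a _ => ?_
  exact tsum_eq_sum fun r hr => h0 _ _ _ _ (by simp [hr])

lemma norm_sum_le_of_gcd_le {I R : Finset ℕ} (hI : ∀ m ∈ I, ∀ n ∈ I, m.gcd n ∈ I)
    {F : ℕ → ℕ → ℕ → ℕ → ℂ} {b : ℕ → ℕ → ℕ → ℝ}
    (hb : ∀ g ∈ I, ∀ a ∈ I, ∀ r ∈ R,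
      ‖∑ m ∈ I, ∑ n ∈ I, if m.gcd n = g then F m n a r else 0‖ ≤ b g a r) :
    ‖∑ m ∈ I, ∑ n ∈ I, ∑ a ∈ I, ∑ r ∈ R, F m n a r‖ ≤
      ∑ g ∈ I, ∑ a ∈ I, ∑ r ∈ R, b g a r := by
  have e : ∑ m ∈ I, ∑ n ∈ I, ∑ a ∈ I, ∑ r ∈ R, F m n a r =
      ∑ g ∈ I, ∑ a ∈ I, ∑ r ∈ R, ∑ m ∈ I, ∑ n ∈ I, if m.gcd n = g then F m n a r else 0 := by
    have e1 : ∀ q : ℕ × ℕ, ∑ p ∈ I ×ˢ I, F p.1 p.2 q.1 q.2 =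
        ∑ g ∈ I, ∑ p ∈ I ×ˢ I, if p.1.gcd p.2 = g then F p.1 p.2 q.1 q.2 else 0 := fun q => by
      rw [← sum_fiberwise_of_maps_to (t := I) (g := fun p : ℕ × ℕ => p.1.gcd p.2)
        (fun p hp => hI _ (mem_product.1 hp).1 _ (mem_product.1 hp).2)]
      simp_rw [sum_filter]
    calc ∑ m ∈ I, ∑ n ∈ I, ∑ a ∈ I, ∑ r ∈ R, F m n a r
        = ∑ p ∈ I ×ˢ I, ∑ q ∈ I ×ˢ R, F p.1 p.2 q.1 q.2 := by simp only [sum_product]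
      _ = ∑ q ∈ I ×ˢ R, ∑ p ∈ I ×ˢ I, F p.1 p.2 q.1 q.2 := sum_comm
      _ = ∑ q ∈ I ×ˢ R, ∑ g ∈ I, ∑ p ∈ I ×ˢ I,
          if p.1.gcd p.2 = g then F p.1 p.2 q.1 q.2 else 0 := sum_congr rfl fun q _ => e1 q
      _ = ∑ g ∈ I, ∑ q ∈ I ×ˢ R, ∑ p ∈ I ×ˢ I,
          if p.1.gcd p.2 = g then F p.1 p.2 q.1 q.2 else 0 := sum_comm
      _ = _ := by simp only [sum_product]
  rw [e]
  refine (norm_sum_le _ _).trans (sum_le_sum fun g hg => ?_)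
  refine (norm_sum_le _ _).trans (sum_le_sum fun a ha => ?_)
  refine (norm_sum_le _ _).trans (sum_le_sum fun r hr => hb g hg a ha r hr)

lemma sum_sum_sum_ite_dvd_le (K : ℕ) (R : Finset ℕ) :
    (∑ g ∈ Icc 1 K, ∑ a ∈ Icc 1 K, ∑ r ∈ R, if a ∣ g then 1 / ((g : ℝ) ^ 2 * r) else 0) ≤
      (∑ g ∈ Icc 1 K, 1 / (g : ℝ)) * ∑ r ∈ R, 1 / (r : ℝ) := by
  rw [sum_mul]
  refine sum_le_sum fun g hg => ?_
  have hg0 : (0 : ℝ) < g := by exact_mod_cast (mem_Icc.1 hg).1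
  have hcard : (((Icc 1 K).filter (· ∣ g)).card : ℝ) ≤ g := by
    have : (Icc 1 K).filter (· ∣ g) ⊆ Icc 1 g := fun a ha => by
      rw [mem_filter, mem_Icc] at ha
      exact mem_Icc.2 ⟨ha.1.1, Nat.le_of_dvd (mem_Icc.1 hg).1 ha.2⟩
    simpa using (Nat.cast_le (α := ℝ)).2 (card_le_card this)
  have hnn : 0 ≤ ∑ r ∈ R, 1 / (r : ℝ) := sum_nonneg fun r _ => by positivity
  calc (∑ a ∈ Icc 1 K, ∑ r ∈ R, if a ∣ g then 1 / ((g : ℝ) ^ 2 * r) else 0)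
      = ∑ a ∈ Icc 1 K, if a ∣ g then 1 / (g : ℝ) ^ 2 * ∑ r ∈ R, 1 / (r : ℝ) else 0 := by
        refine sum_congr rfl fun a _ => ?_
        split_ifs
        · rw [mul_sum]
          exact sum_congr rfl fun r _ => by rw [one_div_mul_one_div]
        · simp
    _ = ((Icc 1 K).filter (· ∣ g)).card * (1 / (g : ℝ) ^ 2 * ∑ r ∈ R, 1 / (r : ℝ)) := by
        rw [← sum_filter, sum_const, nsmul_eq_mul]
    _ ≤ g * (1 / (g : ℝ) ^ 2 * ∑ r ∈ R, 1 / (r : ℝ)) := by gcongr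
    _ = _ := by field_simp

end GcdSums

section Assembly

open Finset

lemma exists_tsupport_subset_Ioo {f : ℝ → ℝ} (hf : HasCompactSupport f)
    (hf' : tsupport f ⊆ Set.Ioi 0) :
    ∃ u₀ u₁ : ℝ, 0 < u₀ ∧ u₀ < u₁ ∧ tsupport f ⊆ Set.Ioo u₀ u₁ := by
  rcases (tsupport f).eq_empty_or_nonempty with h | h
  · exact ⟨1, 2, one_pos, one_lt_two, by simp [h]⟩
  obtain ⟨a, ha, ha'⟩ := hf.isCompact.exists_isLeast h
  obtain ⟨b, hb, hb'⟩ := hf.isCompact.exists_isGreatest h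
  have h0 : (0 : ℝ) < a := hf' ha
  have h1 : a ≤ b := ha' hb
  exact ⟨a / 2, b + 1, by linarith, by linarith, fun x hx =>
    ⟨by linarith [ha' hx], by linarith [hb' hx]⟩⟩

/-- The summand of `EGk`. -/
noncomputable def egSummand (k : ℕ) (Φ Ψ : ℝ → ℝ) (Q X : ℝ) (m n a r : ℕ) : ℂ :=
  if 1 ≤ m ∧ 1 ≤ n ∧ 1 ≤ r ∧ a ∣ Nat.gcd m n then
    (((dk k m : ℝ) * (dk k n : ℝ) * Ψ ((m : ℝ) / X) * Ψ ((n : ℝ) / X) *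
        (((ArithmeticFunction.moebius a : ℤ) : ℝ) / (Nat.totient (a * r) : ℝ)) *
        Φ (|((m / Nat.gcd m n : ℕ) : ℝ) - ((n / Nat.gcd m n : ℕ) : ℝ)| /
            ((r : ℝ) * Q)) : ℝ) : ℂ) *
      ∑' χ : DirichletCharacter ℂ (a * r),
        (if χ ≠ 1 then
          χ (((m / Nat.gcd m n : ℕ) : ZMod (a * r))) *
            (starRingEnd ℂ) (χ (((n / Nat.gcd m n : ℕ) : ZMod (a * r))))
        else 0)
  else 0

lemma EGk_eq_tsum_egSummand (k : ℕ) (Φ Ψ : ℝ → ℝ) (Q X : ℝ) :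
    EGk k Φ Ψ Q X = ∑' m, ∑' n, ∑' a, ∑' r, egSummand k Φ Ψ Q X m n a r := rfl

lemma norm_sum_gcd_eq_twist_le {k : ℕ} {Φ Ψ : ℝ → ℝ} {X Q W : ℝ} {K g a r : ℕ}
    (hΨ : ∀ n, n ∉ Icc 1 K → Ψ ((n : ℝ) / X) = 0) (hg : 0 < g)
    {χ : DirichletCharacter ℂ (a * r)}
    (H : ∀ b : ℕ, 0 < b → ∀ S : Finset ℕ, (∀ n : ℕ, n ∉ S → Ψ ((g * b * n : ℕ) / X) = 0) →
      ‖∑ M ∈ S, ∑ N ∈ S, (dk k (g * b * M) * χ M) * (starRingEnd ℂ) (dk k (g * b * N) * χ N) *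
        ((Ψ ((g * b * M : ℕ) / X) * Ψ ((g * b * N : ℕ) / X) *
          Φ (|(b * M : ℝ) - b * N| / (r * Q)) : ℝ) : ℂ)‖ ≤ W / b) :
    ‖∑ m ∈ Icc 1 K, ∑ n ∈ Icc 1 K, if m.gcd n = g then
      ((dk k m * dk k n * Ψ ((m : ℝ) / X) * Ψ ((n : ℝ) / X) *
        Φ (|((m / g : ℕ) : ℝ) - ((n / g : ℕ) : ℝ)| / (r * Q)) : ℝ) : ℂ) *
        (χ (m / g : ℕ) * (starRingEnd ℂ) (χ (n / g : ℕ))) else 0‖ ≤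
      W * ∑ b ∈ Icc 1 K, 1 / (b : ℝ) := by
  rw [sum_sum_ite_gcd_eq hg (f := fun m n =>
    ((dk k m * dk k n * Ψ ((m : ℝ) / X) * Ψ ((n : ℝ) / X) *
        Φ (|((m / g : ℕ) : ℝ) - ((n / g : ℕ) : ℝ)| / (r * Q)) : ℝ) : ℂ) *
        (χ (m / g : ℕ) * (starRingEnd ℂ) (χ (n / g : ℕ))))
    (by rintro m n (h | h) <;> simp [hΨ _ h]), mul_sum]
  refine (norm_sum_le _ _).trans (sum_le_sum fun b hb => ?_)
  have hb0 : 0 < b := (mem_Icc.1 hb).1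
  have hμ : ‖((ArithmeticFunction.moebius b : ℤ) : ℂ)‖ ≤ 1 := by
    rw [Complex.norm_intCast]
    exact_mod_cast ArithmeticFunction.abs_moebius_le_one
  have hχ : ‖χ b‖ ≤ 1 := χ.norm_le_one _
  have e : ∀ M N : ℕ, ((dk k (g * b * M) * dk k (g * b * N) * Ψ (((g * b * M : ℕ) : ℝ) / X) *
      Ψ (((g * b * N : ℕ) : ℝ) / X) *
        Φ (|((g * b * M / g : ℕ) : ℝ) - ((g * b * N / g : ℕ) : ℝ)| / (r * Q)) : ℝ) : ℂ) *
        (χ (g * b * M / g : ℕ) * (starRingEnd ℂ) (χ (g * b * N / g : ℕ))) =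
      (χ b * (starRingEnd ℂ) (χ b)) * ((dk k (g * b * M) * χ M) *
        (starRingEnd ℂ) (dk k (g * b * N) * χ N) *
        ((Ψ ((g * b * M : ℕ) / X) * Ψ ((g * b * N : ℕ) / X) *
          Φ (|(b * M : ℝ) - b * N| / (r * Q)) : ℝ) : ℂ)) := fun M N => by
    have h1 : ∀ n, g * b * n / g = b * n := fun n => by
      rw [mul_assoc, Nat.mul_div_cancel_left _ hg]
    rw [h1, h1]
    simp only [Nat.cast_mul, map_mul, ofReal_mul, ofReal_natCast, map_natCast]
    ring
  simp_rw [e, ← mul_sum]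
  rw [norm_mul, norm_mul, norm_mul, RCLike.norm_conj, mul_one_div]
  refine le_trans ?_ (H b hb0 (Icc 1 K) fun n hn => hΨ _ fun h => hn ?_)
  · refine (mul_le_of_le_one_left (by positivity) hμ).trans
      (mul_le_of_le_one_left (norm_nonneg _) ?_)
    exact mul_le_one₀ hχ (norm_nonneg _) hχ
  · rw [mem_Icc] at h ⊢
    exact ⟨Nat.pos_of_mul_pos_left h.1,
      (Nat.le_mul_of_pos_left _ (Nat.mul_pos hg hb0)).trans h.2⟩

lemma norm_sum_gcd_eq_egSummand_le {k : ℕ} {Φ Ψ : ℝ → ℝ} {X Q W : ℝ} {K g a r : ℕ} (hW : 0 ≤ W)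
    (hΨ : ∀ n, n ∉ Icc 1 K → Ψ ((n : ℝ) / X) = 0) (hg : 0 < g) (hr : 0 < r)
    (H : a ∣ g → ∀ χ : DirichletCharacter ℂ (a * r), χ ≠ 1 → ∀ b : ℕ, 0 < b → ∀ S : Finset ℕ,
      (∀ n : ℕ, n ∉ S → Ψ ((g * b * n : ℕ) / X) = 0) →
      ‖∑ M ∈ S, ∑ N ∈ S, (dk k (g * b * M) * χ M) * (starRingEnd ℂ) (dk k (g * b * N) * χ N) *
        ((Ψ ((g * b * M : ℕ) / X) * Ψ ((g * b * N : ℕ) / X) *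
          Φ (|(b * M : ℝ) - b * N| / (r * Q)) : ℝ) : ℂ)‖ ≤ W / b) :
    ‖∑ m ∈ Icc 1 K, ∑ n ∈ Icc 1 K, if m.gcd n = g then egSummand k Φ Ψ Q X m n a r else 0‖ ≤
      if a ∣ g then W * ∑ b ∈ Icc 1 K, 1 / (b : ℝ) else 0 := by
  split_ifs with hag
  swap
  · rw [sum_eq_zero, norm_zero]
    refine fun m _ => sum_eq_zero fun n _ => ?_
    split_ifs with h
    · rw [egSummand, if_neg]
      rw [h]
      exact fun h' => hag h'.2.2.2
    · rfl
  have ha : 0 < a := Nat.pos_of_dvd_of_pos hag hg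
  have : NeZero (a * r) := ⟨(Nat.mul_pos ha hr).ne'⟩
  have hφ : (0 : ℝ) < (a * r).totient := by
    exact_mod_cast Nat.totient_pos.2 (Nat.mul_pos ha hr)
  set s : Finset (DirichletCharacter ℂ (a * r)) := univ.filter (· ≠ 1) with hs
  have hcard : (s.card : ℝ) ≤ (a * r).totient := by
    rw [← DirichletCharacter.card_eq_totient_of_hasEnoughRootsOfUnity ℂ (a * r),
      Nat.card_eq_fintype_card]
    exact_mod_cast card_le_univ _
  have e : (∑ m ∈ Icc 1 K, ∑ n ∈ Icc 1 K,
      if m.gcd n = g then egSummand k Φ Ψ Q X m n a r else 0) =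
      (((ArithmeticFunction.moebius a : ℤ) : ℂ) / (a * r).totient) * ∑ χ ∈ s,
      ∑ m ∈ Icc 1 K, ∑ n ∈ Icc 1 K, if m.gcd n = g then
      ((dk k m * dk k n * Ψ ((m : ℝ) / X) * Ψ ((n : ℝ) / X) *
        Φ (|((m / g : ℕ) : ℝ) - ((n / g : ℕ) : ℝ)| / (r * Q)) : ℝ) : ℂ) *
        (χ (m / g : ℕ) * (starRingEnd ℂ) (χ (n / g : ℕ))) else 0 := by
    simp_rw [mul_sum]
    refine Eq.trans ?_ sum_comm
    refine sum_congr rfl fun m hm => ?_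
    refine Eq.trans ?_ sum_comm
    refine sum_congr rfl fun n hn => ?_
    split_ifs with h
    · rw [egSummand, if_pos ⟨(mem_Icc.1 hm).1, (mem_Icc.1 hn).1, hr, h ▸ hag⟩, h, tsum_fintype,
        mul_sum, hs, sum_filter]
      refine sum_congr rfl fun χ _ => ?_
      by_cases hχ : χ = 1
      · simp [hχ]
      · rw [if_pos hχ, if_pos hχ]
        push_cast
        ring
    · simp
  rw [e, norm_mul]
  have hμ : ‖((ArithmeticFunction.moebius a : ℤ) : ℂ) / (a * r).totient‖ ≤
      1 / (a * r).totient := by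
    rw [norm_div, Complex.norm_intCast, Complex.norm_natCast]
    gcongr
    exact_mod_cast ArithmeticFunction.abs_moebius_le_one
  have hnn : 0 ≤ W * ∑ b ∈ Icc 1 K, 1 / (b : ℝ) :=
    mul_nonneg hW (sum_nonneg fun b _ => by positivity)
  refine (mul_le_mul hμ ((norm_sum_le _ _).trans (sum_le_card_nsmul _ _ _ fun χ hχ =>
    norm_sum_gcd_eq_twist_le hΨ hg (H hag χ (mem_filter.1 hχ).2))) (norm_nonneg _)
    (by positivity)).trans ?_
  rw [nsmul_eq_mul, ← mul_assoc]
  refine mul_le_of_le_one_left hnn ?_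
  rw [one_div, inv_mul_le_iff₀ hφ, mul_one]
  exact hcard

end Assembly

/-- conditional bound `EG_k(Q;X) ≪_ε X^{2+ε}/Q` on GRH. -/
theorem EGk_bound_GRH (hGRH : GRH) (k : ℕ) (hk : 2 ≤ k) (ε : ℝ) (hε : 0 < ε)
    (Φ Ψ : ℝ → ℝ)
    (hΦsmooth : ContDiff ℝ (⊤ : ℕ∞) Φ) (hΦsupp : HasCompactSupport Φ)
    (hΦpos : ∀ x, 0 ≤ Φ x) (hΦsupp' : tsupport Φ ⊆ Set.Ioi 0)
    (hΦint : ∫ u, Φ u = 1)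
    (hΨsmooth : ContDiff ℝ (⊤ : ℕ∞) Ψ) (hΨsupp : HasCompactSupport Ψ)
    (hΨpos : ∀ x, 0 ≤ Ψ x) (hΨsupp' : tsupport Ψ ⊆ Set.Ioi 0)
    (hΨint : ∫ u, (Ψ u)^2 = 1) :
    ∃ Cε : ℝ, ∀ Q X : ℝ, 1 ≤ Q → 2 ≤ X →
      ‖EGk k Φ Ψ Q X‖ ≤ Cε * X ^ ((2 : ℝ) + ε) / Q := by
  obtain ⟨b₀, b₁, hb₀, -, hΦs⟩ := exists_tsupport_subset_Ioo hΦsupp hΦsupp'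
  obtain ⟨u₀, u₁, hu₀, hu₁, hΨs⟩ := exists_tsupport_subset_Ioo hΨsupp hΨsupp'
  have hu1 : 0 < u₁ := hu₀.trans hu₁
  set e : ℝ := min ε 1 / 4 with he
  have he0 : 0 < e := by positivity
  have he1 : e ≤ 1 := by
    have := min_le_right ε 1
    linarith
  have heε : e * 4 ≤ ε := by
    have := min_le_left ε 1
    linarith
  obtain ⟨C, hC, HC⟩ := hGRH.exists_norm_dk_double_sum_le (k := k) (by omega) hΦsmooth hΦsupp hb₀
    (hΦs.trans Set.Ioo_subset_Ioi_self) hΨsmooth hΨsupp hu₀ hu₁ hΨs he0 he1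
  obtain ⟨C₁, hC₁, HC₁⟩ := exists_sum_one_div_le hu1 he0
  obtain ⟨C₂, hC₂, HC₂⟩ := exists_sum_one_div_le (div_pos hu1 hb₀) he0
  refine ⟨C * C₁ * (C₁ * C₂), fun Q X hQ hX => ?_⟩
  have hX0 : 0 < X := by linarith
  have hQ0 : 0 < Q := by linarith
  set K := ⌊u₁ * X⌋₊ with hK
  set L := ⌊u₁ / b₀ * X⌋₊ with hL
  have hKX : (K : ℝ) ≤ u₁ * X := Nat.floor_le (by positivity)
  have hLX : (L : ℝ) ≤ u₁ / b₀ * X := Nat.floor_le (by positivity)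
  have hΨ0 : ∀ n : ℕ, n ∉ Finset.Icc 1 K → Ψ ((n : ℝ) / X) = 0 := by
    intro n hn
    refine image_eq_zero_of_notMem_tsupport fun h => hn ?_
    obtain ⟨h1, h2⟩ := hΨs h
    rw [div_lt_iff₀ hX0] at h2
    rw [lt_div_iff₀ hX0] at h1
    have h3 : (0 : ℝ) < n := (mul_pos hu₀ hX0).trans h1
    exact Finset.mem_Icc.2 ⟨by exact_mod_cast h3, Nat.le_floor h2.le⟩
  have hF : ∀ m n a r, egSummand k Φ Ψ Q X m n a r ≠ 0 → m ∈ Finset.Icc 1 K ∧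
      n ∈ Finset.Icc 1 K ∧ a ∈ Finset.Icc 1 K ∧ r ∈ Finset.Icc 1 L := by
    intro m n a r h
    rw [egSummand] at h
    split_ifs at h with h'
    swap
    · exact absurd rfl h
    obtain ⟨hm1, hn1, hr1, hag⟩ := h'
    have hmI : m ∈ Finset.Icc 1 K := by
      by_contra hcon
      exact h (by simp [hΨ0 m hcon])
    have hnI : n ∈ Finset.Icc 1 K := by
      by_contra hcon
      exact h (by simp [hΨ0 n hcon])
    have hgm := Nat.gcd_le_left n hm1
    have hg0 : 0 < m.gcd n := Nat.gcd_pos_of_pos_left _ hm1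
    have hmK := (Finset.mem_Icc.1 hmI).2
    have hnK := (Finset.mem_Icc.1 hnI).2
    refine ⟨hmI, hnI, Finset.mem_Icc.2 ⟨Nat.pos_of_dvd_of_pos hag hg0,
      (Nat.le_of_dvd hg0 hag).trans (hgm.trans hmK)⟩, Finset.mem_Icc.2 ⟨hr1, Nat.le_floor ?_⟩⟩
    have hr0 : (0 : ℝ) < r := by exact_mod_cast hr1
    have hΦne : |((m / m.gcd n : ℕ) : ℝ) - ((n / m.gcd n : ℕ) : ℝ)| / (r * Q) ∈ tsupport Φ := by
      by_contra hcon
      exact h (by simp [image_eq_zero_of_notMem_tsupport hcon])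
    have h1 := (hΦs hΦne).1
    rw [lt_div_iff₀ (by positivity)] at h1
    have h2 : ((m / m.gcd n : ℕ) : ℝ) ≤ K := by exact_mod_cast (Nat.div_le_self _ _).trans hmK
    have h3 : ((n / m.gcd n : ℕ) : ℝ) ≤ K := by exact_mod_cast (Nat.div_le_self _ _).trans hnK
    have h4 : |((m / m.gcd n : ℕ) : ℝ) - ((n / m.gcd n : ℕ) : ℝ)| ≤ K := by
      have h5 := Nat.cast_nonneg (α := ℝ) (m / m.gcd n)
      have h6 := Nat.cast_nonneg (α := ℝ) (n / m.gcd n)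
      rw [abs_le]
      constructor <;> linarith
    have h7 : b₀ * r ≤ b₀ * (r * Q) := by
      gcongr
      exact le_mul_of_one_le_right hr0.le hQ
    rw [div_mul_eq_mul_div, le_div_iff₀ hb₀]
    linarith
  set W : ℝ := C * X ^ (2 + e) / Q with hW
  have hW0 : 0 ≤ W := by positivity
  set h : ℝ := ∑ b ∈ Finset.Icc 1 K, 1 / (b : ℝ) with hh
  have hh0 : 0 ≤ h := Finset.sum_nonneg fun b _ => by positivity
  rw [EGk_eq_tsum_egSummand, tsum_tsum_tsum_tsum_eq_sum hF]
  have hgcd : ∀ m ∈ Finset.Icc 1 K, ∀ n ∈ Finset.Icc 1 K, m.gcd n ∈ Finset.Icc 1 K := by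
    intro m hm n _
    rw [Finset.mem_Icc] at hm ⊢
    exact ⟨Nat.gcd_pos_of_pos_left _ hm.1, (Nat.gcd_le_left n hm.1).trans hm.2⟩
  refine (norm_sum_le_of_gcd_le hgcd (b := fun g a r =>
    W * h * if a ∣ g then 1 / ((g : ℝ) ^ 2 * r) else 0) fun g hg a _ r hr => ?_).trans ?_
  · have hg0 := (Finset.mem_Icc.1 hg).1
    have hr0 := (Finset.mem_Icc.1 hr).1
    have hgR : (0 : ℝ) < g := by exact_mod_cast hg0
    have hrR : (0 : ℝ) < r := by exact_mod_cast hr0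
    refine (norm_sum_gcd_eq_egSummand_le (W := W / (g ^ 2 * r)) (by positivity) hΨ0 hg0 hr0
      fun hag χ hχ b hb S hS => ?_).trans (le_of_eq ?_)
    · refine (HC X Q (by linarith) hQ g b a r hg0 hb hr0 hag χ hχ S hS).trans (le_of_eq ?_)
      have hbR : (0 : ℝ) < b := by exact_mod_cast hb
      rw [hW]
      field_simp
    · split_ifs <;> ring
  · simp_rw [← Finset.mul_sum]
    have h1 := HC₁ X hX0 K hKX
    have h2 := HC₂ X hX0 L hLX
    have hX4 : X ^ (2 + e) * X ^ e * (X ^ e * X ^ e) ≤ X ^ (2 + ε) := by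
      rw [← Real.rpow_add hX0, ← Real.rpow_add hX0, ← Real.rpow_add hX0]
      exact Real.rpow_le_rpow_of_exponent_le (by linarith) (by linarith)
    calc W * h * ∑ g ∈ Finset.Icc 1 K, ∑ a ∈ Finset.Icc 1 K, ∑ r ∈ Finset.Icc 1 L,
          (if a ∣ g then 1 / ((g : ℝ) ^ 2 * r) else 0)
        ≤ W * h * (h * ∑ r ∈ Finset.Icc 1 L, 1 / (r : ℝ)) := by
          gcongr
          exact sum_sum_sum_ite_dvd_le K _
      _ ≤ W * (C₁ * X ^ e) * ((C₁ * X ^ e) * (C₂ * X ^ e)) := by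
          gcongr
      _ = C * C₁ * (C₁ * C₂) * (X ^ (2 + e) * X ^ e * (X ^ e * X ^ e)) / Q := by
          rw [hW]
          ring
      _ ≤ _ := by gcongr
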